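/- arXiv:2301.05807 — 2 statements merged into one kernel-verified Lean document; each statement's English description precedes it below -/
import Mathlib

section
/- For every α ∈ ℝ and every κ ∈ ℝ there exist X ∈ ℝ and a smooth function q : (X,∞) → ℝ, nonvanishing on (X,∞) when κ ≠ 0 and identically zero when κ = 0, solving PIV(α) on (X,∞) and satisfying q(x) = κ·2^{α−1/2}·x^{2α−1}·e^{−x²}·(1+O(x^{−2})) as x → +∞. Moreover this solution is unique: if q₁ on (X₁,∞) and q₂ on (X₂,∞) both solve PIV(α) with this asymptotic behavior for the same α and κ, then q₁(x) = q₂(x) for all x > max(X₁,X₂). -/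
open Real Filter Set Asymptotics MeasureTheory

noncomputable section

/-- The fourth Painlevé equation PIV(α) at a point `x`:
`q'' = (q')²/(2q) + (3/2)q³ + 4xq² + 2(x²-2α)q`. -/
def PIVEq (α : ℝ) (q : ℝ → ℝ) (x : ℝ) : Prop :=
  deriv (deriv q) x =
    (deriv q x) ^ 2 / (2 * q x) + (3 / 2) * (q x) ^ 3 + 4 * x * (q x) ^ 2 +
      2 * (x ^ 2 - 2 * α) * q x

/-- Clarkson–McLeod boundary behavior
`q(x) = κ·2^{α-1/2}·x^{2α-1}·e^{-x²}·(1+O(x⁻²))` as `x → +∞`. -/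
def CMAsymp (α κ : ℝ) (q : ℝ → ℝ) : Prop :=
  ∃ E : ℝ → ℝ, (E =O[atTop] fun x : ℝ => x ^ (-2 : ℝ)) ∧
    ∀ᶠ x : ℝ in atTop,
      q x = κ * (2 : ℝ) ^ (α - 1 / 2) * x ^ (2 * α - 1) * Real.exp (-x ^ 2) * (1 + E x)

/-! ### Gronwall-type lemmas -/

lemma gron_left (w w' : ℝ → ℝ) (C c b : ℝ) (hcb : c ≤ b) (hc : ContinuousOn w (Icc c b))
    (hd : ∀ x ∈ Ioo c b, HasDerivAt w (w' x) x)
    (hb : ∀ x ∈ Ioo c b, -(C * w x) ≤ w' x) (hw : w b ≤ 0) : w c ≤ 0 := by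
  have hmono : MonotoneOn (fun x => w x * Real.exp (C * x)) (Icc c b) := by
    apply monotoneOn_of_hasDerivWithinAt_nonneg (convex_Icc c b)
      (f' := fun x => w' x * Real.exp (C * x) + w x * (Real.exp (C * x) * C))
    · exact hc.mul (by fun_prop)
    · intro x hx
      rw [interior_Icc] at hx
      have h1 : HasDerivAt (fun x : ℝ => Real.exp (C * x)) (Real.exp (C * x) * C) x := by
        have := ((hasDerivAt_id x).const_mul C).exp
        simpa using this
      exact ((hd x hx).mul h1).hasDerivWithinAt
    · intro x hx
      rw [interior_Icc] at hx
      have h2 := hb x hx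
      have h3 : w' x * Real.exp (C * x) + w x * (Real.exp (C * x) * C)
        = (w' x + C * w x) * Real.exp (C * x) := by ring
      rw [h3]
      exact mul_nonneg (by linarith) (Real.exp_pos _).le
  have h := hmono (left_mem_Icc.2 hcb) (right_mem_Icc.2 hcb) hcb
  simp only at h
  have h5 : w b * Real.exp (C * b) ≤ 0 := mul_nonpos_of_nonpos_of_nonneg hw (Real.exp_pos _).le
  by_contra h6
  push Not at h6
  have := mul_pos h6 (Real.exp_pos (C * c))
  linarith

lemma gron_right (w w' : ℝ → ℝ) (C c b : ℝ) (hcb : c ≤ b) (hc : ContinuousOn w (Icc c b))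
    (hd : ∀ x ∈ Ioo c b, HasDerivAt w (w' x) x)
    (hb : ∀ x ∈ Ioo c b, w' x ≤ C * w x) (hw : w c ≤ 0) : w b ≤ 0 := by
  have hmaps : MapsTo (fun x : ℝ => -x) (Icc (-b) (-c)) (Icc c b) := by
    intro x hx
    exact ⟨by linarith [hx.2], by linarith [hx.1]⟩
  have := gron_left (fun x => w (-x)) (fun x => - w' (-x)) C (-b) (-c) (by linarith)
    (hc.comp (by fun_prop) hmaps) ?_ ?_ (by simpa using hw)
  · simpa using this
  · intro x hx
    have h := (hd (-x) ⟨by linarith [hx.2], by linarith [hx.1]⟩)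
    have h2 := h.comp x (hasDerivAt_neg x)
    simpa [Function.comp_def] using h2
  · intro x hx
    have h := (hb (-x) ⟨by linarith [hx.2], by linarith [hx.1]⟩)
    simpa using h

lemma smooth_derivs {q : ℝ → ℝ} {X : ℝ} (hq : ContDiffOn ℝ (⊤ : ℕ∞) q (Ioi X)) :
    (∀ x, X < x → HasDerivAt q (deriv q x) x) ∧
    (∀ x, X < x → HasDerivAt (deriv q) (deriv (deriv q) x) x) ∧
    ContinuousOn (deriv (deriv q)) (Ioi X) := by
  have h1 : ContDiffOn ℝ (⊤ : ℕ∞) (deriv q) (Ioi X) :=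
    hq.deriv_of_isOpen isOpen_Ioi (by exact le_rfl)
  have h2 : ContDiffOn ℝ (⊤ : ℕ∞) (deriv (deriv q)) (Ioi X) :=
    h1.deriv_of_isOpen isOpen_Ioi (by exact le_rfl)
  refine ⟨fun x hx => ?_, fun x hx => ?_, h2.continuousOn⟩
  · exact ((hq.differentiableOn (by simp)).differentiableAt (Ioi_mem_nhds hx)).hasDerivAt
  · exact ((h1.differentiableOn (by simp)).differentiableAt (Ioi_mem_nhds hx)).hasDerivAt

/-- The energy function used for the zero dichotomy. -/
def pivW (q : ℝ → ℝ) (x : ℝ) : ℝ := q x + (deriv q x) ^ 2 / (4 * q x)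

lemma pivW_cont {α : ℝ} {q : ℝ → ℝ} {X : ℝ} (hq : ContDiffOn ℝ (⊤ : ℕ∞) q (Ioi X))
    (he : ∀ x ∈ Ioi X, PIVEq α q x) : ContinuousOn (pivW q) (Ioi X) := by
  have hc := hq.continuousOn
  have hc2 := (smooth_derivs hq).2.2
  have : ContinuousOn (fun x => q x + (deriv (deriv q) x - ((3 / 2) * (q x) ^ 3 +
      4 * x * (q x) ^ 2 + 2 * (x ^ 2 - 2 * α) * q x)) / 2) (Ioi X) := by fun_prop
  refine this.congr ?_
  intro x hx
  have h := he x hx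
  unfold PIVEq at h
  simp only [pivW]
  rw [h]
  have : (deriv q x) ^ 2 / (4 * q x) = (deriv q x) ^ 2 / (2 * q x) / 2 := by
    rw [div_div]; ring
  rw [this]; ring

lemma pivW_deriv {α : ℝ} {q : ℝ → ℝ} {X : ℝ} (hq : ContDiffOn ℝ (⊤ : ℕ∞) q (Ioi X))
    (he : ∀ x ∈ Ioi X, PIVEq α q x) {x : ℝ} (hx : X < x) (h0 : q x ≠ 0) :
    HasDerivAt (pivW q) (deriv q x * (1 + 3 / 4 * q x ^ 2 + 2 * x * q x + (x ^ 2 - 2 * α))) x := by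
  obtain ⟨h1, h2, -⟩ := smooth_derivs hq
  have h := (h1 x hx).add (((h2 x hx).pow 2).div ((h1 x hx).const_mul 4)
    (mul_ne_zero (by norm_num) h0))
  refine h.congr_deriv ?_
  have e := he x hx
  unfold PIVEq at e
  rw [e]
  simp only [Pi.pow_apply]
  field_simp
  ring

lemma pivW_key (q p c C : ℝ) (h0 : q ≠ 0) (hC : |c| ≤ C) :
    |2 * (q + p ^ 2 / (4 * q)) * (p * c)| ≤ 2 * C * (q + p ^ 2 / (4 * q)) ^ 2 := by
  set w := q + p ^ 2 / (4 * q) with hw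
  have h1 : p ^ 2 ≤ w ^ 2 := by
    have : w ^ 2 - p ^ 2 = (q - p ^ 2 / (4 * q)) ^ 2 := by
      rw [hw]; field_simp; ring
    nlinarith [sq_nonneg (q - p ^ 2 / (4 * q))]
  have h2 : |p| ≤ |w| := sq_le_sq.1 h1
  rw [abs_mul, abs_mul, abs_mul, ← sq_abs w, abs_two]
  have h3 : |p| * |c| ≤ |w| * C := mul_le_mul h2 hC (abs_nonneg _) (abs_nonneg _)
  nlinarith [abs_nonneg w]

lemma pivW_zero (q p : ℝ) (h : (q + p ^ 2 / (4 * q)) ^ 2 ≤ 0) : q = 0 := by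
  by_contra h0
  have h1 : q + p ^ 2 / (4 * q) = 0 := by nlinarith [sq_nonneg (q + p ^ 2 / (4 * q))]
  field_simp at h1
  have : 0 < q ^ 2 := by positivity
  nlinarith [sq_nonneg p]

/-- A solution vanishing somewhere vanishes identically. -/
lemma zero_dichotomy {α : ℝ} {q : ℝ → ℝ} {X : ℝ} (hq : ContDiffOn ℝ (⊤ : ℕ∞) q (Ioi X))
    (he : ∀ x ∈ Ioi X, PIVEq α q x) {b c : ℝ} (hb : X < b) (hc : X < c) (h0 : q b = 0) :
    q c = 0 := by
  by_contra hne
  have hcq := hq.continuousOn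
  have hbd : ∀ l r : ℝ, X < l → ∃ C, ∀ x ∈ Icc l r,
      |1 + 3 / 4 * q x ^ 2 + 2 * x * q x + (x ^ 2 - 2 * α)| ≤ C := by
    intro l r hl
    have hsub : Icc l r ⊆ Ioi X := fun x hx => lt_of_lt_of_le hl hx.1
    have hcq' := hcq.mono hsub
    have : ContinuousOn (fun x => 1 + 3 / 4 * q x ^ 2 + 2 * x * q x + (x ^ 2 - 2 * α))
        (Icc l r) := by fun_prop
    obtain ⟨C, hC⟩ := isCompact_Icc.exists_bound_of_continuousOn this
    exact ⟨C, hC⟩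
  have hw2d : ∀ x, X < x → q x ≠ 0 → HasDerivAt (fun x => pivW q x ^ 2)
      (2 * pivW q x * (deriv q x *
        (1 + 3 / 4 * q x ^ 2 + 2 * x * q x + (x ^ 2 - 2 * α)))) x := by
    intro x hx hx0
    have := (pivW_deriv hq he hx hx0).pow 2
    refine this.congr_deriv ?_
    simp
  have hwc : ContinuousOn (fun x => pivW q x ^ 2) (Ioi X) := (pivW_cont hq he).pow 2
  have hclosed : ∀ l r : ℝ, X < l → IsCompact (Icc l r ∩ q ⁻¹' {0}) := by
    intro l r hl
    have hsub : Icc l r ⊆ Ioi X := fun x hx => lt_of_lt_of_le hl hx.1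
    exact isCompact_Icc.of_isClosed_subset
      ((hcq.mono hsub).preimage_isClosed_of_isClosed isClosed_Icc isClosed_singleton)
      inter_subset_left
  rcases lt_trichotomy c b with h | h | h
  · obtain ⟨z, hz⟩ := (hclosed c b hc).exists_isLeast ⟨b, ⟨h.le, le_rfl⟩, h0⟩
    obtain ⟨C, hC⟩ := hbd c z hc
    have hnz : ∀ x ∈ Ioo c z, q x ≠ 0 := by
      intro x hx hx0
      have := hz.2 ⟨⟨hx.1.le, hx.2.le.trans hz.1.1.2⟩, hx0⟩
      linarith [hx.2]
    have hz0 : q z = 0 := hz.1.2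
    have := gron_left (fun x => pivW q x ^ 2) _ (2 * C) c z hz.1.1.1
      (hwc.mono fun x hx => lt_of_lt_of_le hc hx.1)
      (fun x hx => hw2d x (hc.trans hx.1) (hnz x hx))
      (fun x hx => (abs_le.1 (pivW_key _ _ _ C (hnz x hx) (hC x ⟨hx.1.le, hx.2.le⟩))).1)
      (by simp [pivW, hz0])
    exact hne (pivW_zero _ _ this)
  · exact hne (h ▸ h0)
  · obtain ⟨z, hz⟩ := (hclosed b c hb).exists_isGreatest ⟨b, ⟨le_rfl, h.le⟩, h0⟩
    have hXz : X < z := lt_of_lt_of_le hb hz.1.1.1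
    obtain ⟨C, hC⟩ := hbd z c hXz
    have hnz : ∀ x ∈ Ioo z c, q x ≠ 0 := by
      intro x hx hx0
      have := hz.2 ⟨⟨hz.1.1.1.trans hx.1.le, hx.2.le⟩, hx0⟩
      linarith [hx.1]
    have hz0 : q z = 0 := hz.1.2
    have := gron_right (fun x => pivW q x ^ 2) _ (2 * C) z c hz.1.1.2
      (hwc.mono fun x hx => lt_of_lt_of_le hXz hx.1)
      (fun x hx => hw2d x (hXz.trans hx.1) (hnz x hx))
      (fun x hx => (abs_le.1 (pivW_key _ _ _ C (hnz x hx) (hC x ⟨hx.1.le, hx.2.le⟩))).2)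
      (by simp [pivW, hz0])
    exact hne (pivW_zero _ _ this)

/-- The square root substitution. -/
lemma sqrt_subst {α : ℝ} {q : ℝ → ℝ} {X s : ℝ} (hq : ContDiffOn ℝ (⊤ : ℕ∞) q (Ioi X))
    (he : ∀ x ∈ Ioi X, PIVEq α q x) (hs : s ^ 2 = 1) (hpos : ∀ x, X < x → 0 < s * q x) :
    ∃ u' : ℝ → ℝ, ∀ x, X < x → HasDerivAt (fun x => √(s * q x)) (u' x) x ∧
      HasDerivAt u' ((x ^ 2 - 2 * α) * √(s * q x) + 2 * x * s * √(s * q x) ^ 3 +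
        3 / 4 * √(s * q x) ^ 5) x := by
  obtain ⟨h1, h2, -⟩ := smooth_derivs hq
  refine ⟨fun x => s * deriv q x / (2 * √(s * q x)), fun x hx => ?_⟩
  have hu := ((h1 x hx).const_mul s).sqrt (hpos x hx).ne'
  refine ⟨hu, ?_⟩
  have hup : 0 < √(s * q x) := Real.sqrt_pos.2 (hpos x hx)
  have h := ((h2 x hx).const_mul s).div (hu.const_mul 2) (by positivity)
  refine h.congr_deriv ?_
  have e := he x hx
  unfold PIVEq at e
  rw [e]
  have hsq : √(s * q x) ^ 2 = s * q x := Real.sq_sqrt (hpos x hx).le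
  have hq' : q x = s * √(s * q x) ^ 2 := by rw [hsq]; linear_combination (-(q x)) * hs
  generalize √(s * q x) = u at *
  generalize deriv q x = p at *
  rw [hq']
  have hs0 : s ≠ 0 := by rintro rfl; norm_num at hs
  have hu0 := hup.ne'
  rcases sq_eq_one_iff.1 hs with rfl | rfl
  all_goals
    field_simp
    ring

/-- Linear uniqueness at infinity. -/
lemma lin_inf (d e a H : ℝ → ℝ) (C X : ℝ)
    (hd : ∀ x, X < x → HasDerivAt d (e x) x)
    (he : ∀ x, X < x → HasDerivAt e (a x * e x + H x * d x) x)
    (hH : ∀ x, X < x → |H x| ≤ C / x ^ 2) (ha : ∀ x, X < x → x ≤ a x)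
    (hlim : Tendsto d atTop (nhds 0)) : ∃ Y, X ≤ Y ∧ ∀ x, Y < x → d x = 0 := by
  set K := C + 1 with hK
  set Y := max X (max 1 (K ^ 2 + 1)) with hY
  have hYX : X ≤ Y := le_max_left _ _
  have hY1 : 1 ≤ Y := (le_max_left _ _).trans (le_max_right _ _)
  have hYK : K ^ 2 + 1 ≤ Y := (le_max_right _ _).trans (le_max_right _ _)
  set E : ℝ → ℝ := fun x => e x ^ 2 - d x ^ 2 / x ^ 4 with hE
  set E' : ℝ → ℝ := fun x => 2 * e x * (a x * e x + H x * d x)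
    - (2 * d x * e x / x ^ 4 - 4 * d x ^ 2 / x ^ 5) with hE'
  have hEd : ∀ x, Y < x → HasDerivAt E (E' x) x := by
    intro x hx
    have hx0 : x ≠ 0 := by linarith
    have h := ((he x (by linarith)).pow 2).sub
      (((hd x (by linarith)).pow 2).div ((hasDerivAt_id x).pow 4) (pow_ne_zero 4 hx0))
    refine h.congr_deriv ?_
    simp only [hE', Pi.pow_apply, id]
    field_simp
    ring
  have hEE : ∀ x, Y < x → E x ≤ E' x := by
    intro x hx
    have hx1 : 1 < x := by linarith
    have hx0 : 0 < x := by linarith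
    have h1 : |H x - 1 / x ^ 4| ≤ K / x ^ 2 := by
      have h2 : |1 / x ^ 4| ≤ 1 / x ^ 2 := by
        rw [abs_of_pos (by positivity)]
        apply one_div_le_one_div_of_le (by positivity)
        exact pow_le_pow_right₀ hx1.le (by norm_num)
      calc |H x - 1 / x ^ 4| ≤ |H x| + |1 / x ^ 4| := abs_sub _ _
        _ ≤ C / x ^ 2 + 1 / x ^ 2 := add_le_add (hH x (by linarith)) h2
        _ = K / x ^ 2 := by rw [hK]; ring
    have h3 : 2 * a x - 1 ≥ K ^ 2 := by
      have := ha x (by linarith); nlinarith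
    have h4 : E' x - E x = (2 * a x - 1) * e x ^ 2 + 2 * ((H x - 1 / x ^ 4) * (d x * e x))
        + 4 * d x ^ 2 / x ^ 5 + d x ^ 2 / x ^ 4 := by
      simp only [hE', hE]; field_simp; ring
    have h5 : |(H x - 1 / x ^ 4) * (d x * e x)| ≤ K / x ^ 2 * (|d x| * |e x|) := by
      rw [abs_mul, abs_mul]
      exact mul_le_mul_of_nonneg_right h1 (by positivity)
    have h6 := (abs_le.1 h5).1
    have h7 : (K * |e x| - |d x| / x ^ 2) ^ 2
        = K ^ 2 * e x ^ 2 - 2 * (K / x ^ 2 * (|d x| * |e x|)) + d x ^ 2 / x ^ 4 := by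
      rw [← sq_abs (e x), ← sq_abs (d x)]; field_simp; ring
    have h8 : 0 ≤ 4 * d x ^ 2 / x ^ 5 := by positivity
    have h9 : K ^ 2 * e x ^ 2 ≤ (2 * a x - 1) * e x ^ 2 :=
      mul_le_mul_of_nonneg_right h3 (sq_nonneg _)
    nlinarith [sq_nonneg (K * |e x| - |d x| / x ^ 2)]
  -- the energy is nonpositive
  have hEneg : ∀ x, Y < x → E x ≤ 0 := by
    intro x₁ hx₁
    by_contra hpos
    push Not at hpos
    have hgrow : ∀ x, x₁ ≤ x → E x₁ ≤ E x := by
      intro x hx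
      have := gron_right (fun t => E x₁ - E t) (fun t => - E' t) 1 x₁ x hx
        (fun t ht => ((hEd t (lt_of_lt_of_le hx₁ ht.1)).const_sub
          (E x₁)).continuousAt.continuousWithinAt)
        (fun t ht => (hEd t (hx₁.trans ht.1)).const_sub (E x₁))
        (fun t ht => by
          have := hEE t (hx₁.trans ht.1); linarith) (by simp)
      simpa using this
    set m := √(E x₁) with hm
    have hmpos : 0 < m := Real.sqrt_pos.2 hpos
    have he2 : ∀ x, x₁ ≤ x → m ≤ |e x| := by
      intro x hx
      rw [hm]
      apply Real.sqrt_le_iff.2 ⟨abs_nonneg _, ?_⟩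
      rw [sq_abs]
      have h1 := hgrow x hx
      have h2 : E x ≤ e x ^ 2 := by
        simp only [hE]
        have : 0 ≤ d x ^ 2 / x ^ 4 := by positivity
        linarith
      linarith
    have hbig : ∀ x, x₁ < x → m * (x - x₁) ≤ |d x - d x₁| := by
      intro x hx
      obtain ⟨c, hc, hc'⟩ := exists_hasDerivAt_eq_slope d e hx
        (fun t ht => (hd t (by linarith [ht.1])).continuousAt.continuousWithinAt)
        (fun t ht => hd t (by linarith [ht.1]))
      have hne : x - x₁ ≠ 0 := by linarith
      have : d x - d x₁ = e c * (x - x₁) := by rw [hc']; field_simp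
      rw [this, abs_mul, abs_of_pos (show 0 < x - x₁ by linarith)]
      exact mul_le_mul_of_nonneg_right (he2 c hc.1.le) (by linarith)
    have hl : Tendsto (fun x => |d x - d x₁|) atTop (nhds |0 - d x₁|) :=
      (hlim.sub_const _).abs
    have ht : Tendsto (fun x => m * (x - x₁)) atTop atTop :=
      (tendsto_atTop_add_const_right _ (-x₁) tendsto_id).const_mul_atTop hmpos
    have ht2 : Tendsto (fun x => |d x - d x₁|) atTop atTop :=
      tendsto_atTop_mono' _ ((eventually_gt_atTop x₁).mono hbig) ht
    exact not_tendsto_nhds_of_tendsto_atTop ht2 _ hl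
  refine ⟨Y, hYX, fun x hx => ?_⟩
  set g : ℝ → ℝ := fun t => d t ^ 2 * Real.exp (-2 / t) with hg
  have hgm : MonotoneOn g (Ici x) := by
    have hgd : ∀ t, Y < t → HasDerivAt g (2 * d t * e t * Real.exp (-2 / t)
        + d t ^ 2 * (Real.exp (-2 / t) * (2 / t ^ 2))) t := by
      intro t ht
      have ht0 : t ≠ 0 := by linarith
      have h1 : HasDerivAt (fun t : ℝ => -2 / t) (2 / t ^ 2) t := by
        have := (hasDerivAt_const t (-2 : ℝ)).div (hasDerivAt_id t) ht0
        refine this.congr_deriv ?_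
        simp
      have := ((hd t (by linarith)).pow 2).mul h1.exp
      refine this.congr_deriv ?_
      simp
    apply monotoneOn_of_hasDerivWithinAt_nonneg (convex_Ici x)
      (f' := fun t => 2 * d t * e t * Real.exp (-2 / t)
        + d t ^ 2 * (Real.exp (-2 / t) * (2 / t ^ 2)))
    · intro t ht
      exact (hgd t (lt_of_lt_of_le hx ht)).continuousAt.continuousWithinAt
    · intro t ht
      rw [interior_Ici] at ht
      exact (hgd t (hx.trans ht)).hasDerivWithinAt
    · intro t ht
      rw [interior_Ici] at ht
      have htY : Y < t := hx.trans ht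
      have ht0 : 0 < t := by linarith
      have h1 := hEneg t htY
      simp only [hE] at h1
      have h2 : |e t| ≤ |d t| / t ^ 2 := by
        have : e t ^ 2 ≤ (d t / t ^ 2) ^ 2 := by
          rw [div_pow, ← pow_mul]; linarith
        have := sq_le_sq.1 this
        rwa [abs_div, abs_of_pos (show 0 < t ^ 2 by positivity)] at this
      have h3 : -(d t ^ 2 / t ^ 2) ≤ d t * e t := by
        have : |d t * e t| ≤ d t ^ 2 / t ^ 2 := by
          rw [abs_mul, ← sq_abs (d t)]
          calc |d t| * |e t| ≤ |d t| * (|d t| / t ^ 2) :=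
                mul_le_mul_of_nonneg_left h2 (abs_nonneg _)
            _ = _ := by ring
        exact (abs_le.1 this).1
      have h4 : 2 * d t * e t * Real.exp (-2 / t)
        + d t ^ 2 * (Real.exp (-2 / t) * (2 / t ^ 2))
        = 2 * (d t * e t + d t ^ 2 / t ^ 2) * Real.exp (-2 / t) := by ring
      rw [h4]
      have := Real.exp_pos (-2 / t)
      have h5 : 0 ≤ d t * e t + d t ^ 2 / t ^ 2 := by linarith
      positivity
  have hglim : Tendsto g atTop (nhds 0) := by
    have h1 : Tendsto (fun t : ℝ => Real.exp (-2 / t)) atTop (nhds (Real.exp 0)) :=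
      (Real.continuous_exp.tendsto 0).comp (tendsto_id.const_div_atTop (-2 : ℝ))
    have := (hlim.pow 2).mul h1
    simpa using this
  have hgx : g x ≤ 0 := by
    refine ge_of_tendsto hglim ?_
    filter_upwards [eventually_ge_atTop x] with t ht
    exact hgm self_mem_Ici ht ht
  simp only [hg] at hgx
  by_contra hdx
  have : 0 < d x ^ 2 * Real.exp (-2 / x) := by positivity
  linarith

/-- Linear backward uniqueness. -/
lemma lin_back (d e h : ℝ → ℝ) (X c b : ℝ) (hX : X < c) (hcb : c ≤ b)
    (hd : ∀ x, X < x → HasDerivAt d (e x) x)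
    (he : ∀ x, X < x → HasDerivAt e (h x * d x) x)
    (hh : ContinuousOn h (Icc c b)) (hdb : d b = 0) (heb : e b = 0) : d c = 0 := by
  obtain ⟨M, hM⟩ := isCompact_Icc.exists_bound_of_continuousOn hh
  have hder : ∀ x, X < x → HasDerivAt (fun x => d x ^ 2 + e x ^ 2)
      (2 * (d x * e x) * (1 + h x)) x := by
    intro x hx
    refine (((hd x hx).pow 2).add ((he x hx).pow 2)).congr_deriv ?_
    simp; ring
  have := gron_left (fun x => d x ^ 2 + e x ^ 2) (fun x => 2 * (d x * e x) * (1 + h x)) (1 + M) c b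
    hcb (fun x hx => (hder x (lt_of_lt_of_le hX hx.1)).continuousAt.continuousWithinAt)
    (fun x hx => hder x (hX.trans hx.1)) ?_ (by simp [hdb, heb])
  · nlinarith [sq_nonneg (d c), sq_nonneg (e c)]
  · intro x hx
    have h1 : |1 + h x| ≤ 1 + M := by
      have := hM x ⟨hx.1.le, hx.2.le⟩
      rw [Real.norm_eq_abs] at this
      calc |1 + h x| ≤ |(1 : ℝ)| + |h x| := abs_add_le _ _
        _ ≤ 1 + M := by rw [abs_one]; linarith
    have h2 : |2 * (d x * e x)| ≤ d x ^ 2 + e x ^ 2 := by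
      rw [abs_le]; constructor <;> nlinarith [sq_nonneg (d x + e x), sq_nonneg (d x - e x)]
    have h3 : |2 * (d x * e x) * (1 + h x)| ≤ (1 + M) * (d x ^ 2 + e x ^ 2) := by
      rw [abs_mul, mul_comm (1 + M)]
      exact mul_le_mul h2 h1 (abs_nonneg _) (by positivity)
    exact (abs_le.1 h3).1

/-- The leading profile. -/
def pivP (α x : ℝ) : ℝ := x ^ (2 * α - 1) * Real.exp (-x ^ 2)

def pivA (α x : ℝ) : ℝ := 2 * x - (2 * α - 1) / x

lemma pivP_pos (α : ℝ) {x : ℝ} (hx : 0 < x) : 0 < pivP α x :=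
  mul_pos (Real.rpow_pos_of_pos hx _) (Real.exp_pos _)

lemma pivP_deriv (α : ℝ) {x : ℝ} (hx : 0 < x) :
    HasDerivAt (pivP α) (-(pivA α x * pivP α x)) x := by
  have h1 := Real.hasDerivAt_rpow_const (x := x) (p := 2 * α - 1) (Or.inl hx.ne')
  have h2 : HasDerivAt (fun x : ℝ => Real.exp (-x ^ 2)) (Real.exp (-x ^ 2) * (-(2 * x))) x := by
    have := ((hasDerivAt_id x).pow 2).neg.exp
    refine this.congr_deriv ?_
    simp
  refine (h1.mul h2).congr_deriv ?_
  rw [Real.rpow_sub_one hx.ne']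
  simp only [pivA, pivP]
  field_simp
  ring

lemma pivA_deriv (α : ℝ) {x : ℝ} (hx : 0 < x) :
    HasDerivAt (pivA α) (2 + (2 * α - 1) / x ^ 2) x := by
  have := ((hasDerivAt_id x).const_mul 2).sub
    ((hasDerivAt_const x (2 * α - 1)).div (hasDerivAt_id x) hx.ne')
  refine this.congr_deriv ?_
  simp
  ring

lemma pivP_decay (α : ℝ) (n : ℕ) : Tendsto (fun x => x ^ n * pivP α x) atTop (nhds 0) := by
  have h := tendsto_rpow_mul_exp_neg_mul_atTop_nhds_zero (n + (2 * α - 1)) 1 one_pos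
  refine squeeze_zero' ?_ ?_ h
  · filter_upwards [eventually_gt_atTop 0] with x hx
    have := pivP_pos α hx
    positivity
  · filter_upwards [eventually_gt_atTop 1] with x hx
    have hx0 : 0 < x := by linarith
    rw [Real.rpow_add hx0, Real.rpow_natCast, pivP, ← mul_assoc]
    apply mul_le_mul_of_nonneg_left
    · apply Real.exp_le_exp.2; nlinarith
    · have := Real.rpow_nonneg hx0.le (2 * α - 1)
      positivity

lemma cm_limit {α κ : ℝ} {q : ℝ → ℝ} (h : CMAsymp α κ q) :
    Tendsto (fun x => q x / pivP α x) atTop (nhds (κ * (2 : ℝ) ^ (α - 1 / 2))) := by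
  obtain ⟨E, hE, hq⟩ := h
  have h0 : Tendsto E atTop (nhds 0) :=
    hE.trans_tendsto (tendsto_rpow_neg_atTop (by norm_num : (0 : ℝ) < 2))
  have h1 : Tendsto (fun x => κ * (2 : ℝ) ^ (α - 1 / 2) * (1 + E x)) atTop
      (nhds (κ * (2 : ℝ) ^ (α - 1 / 2))) := by
    simpa using (h0.const_add 1).const_mul (κ * (2 : ℝ) ^ (α - 1 / 2))
  refine h1.congr' ?_
  filter_upwards [hq, eventually_gt_atTop 0] with x hx hx0
  have := (pivP_pos α hx0).ne'
  rw [eq_div_iff this, hx, pivP]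
  ring

lemma sign_const {q : ℝ → ℝ} {X s : ℝ} (hq : ContinuousOn q (Ioi X)) (hs : s ≠ 0)
    (hne : ∀ x, X < x → q x ≠ 0) (hev : ∀ᶠ x in atTop, 0 < s * q x) :
    ∀ x, X < x → 0 < s * q x := by
  intro x hx
  by_contra hneg
  push Not at hneg
  obtain ⟨y, hy, hyX⟩ := (hev.and (eventually_gt_atTop X)).exists
  have hc : ContinuousOn (fun x => s * q x) (Ioi X) := by fun_prop
  obtain ⟨z, hz, hz0⟩ := isPreconnected_Ioi.intermediate_value (a := x) (b := y) hx hyX hc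
    ⟨hneg, hy.le⟩
  exact (mul_ne_zero hs (hne z hz)) hz0

lemma pivN_bound (x s a b : ℝ) (hx : 1 ≤ x) (hs : |s| = 1) (ha0 : 0 ≤ a) (hb0 : 0 ≤ b)
    (ha : a ^ 2 ≤ 1 / x ^ 3) (hb : b ^ 2 ≤ 1 / x ^ 3) :
    |2 * x * s * (a ^ 2 + a * b + b ^ 2) +
      3 / 4 * (a ^ 4 + a ^ 3 * b + a ^ 2 * b ^ 2 + a * b ^ 3 + b ^ 4)| ≤ 10 / x ^ 2 := by
  have hx0 : 0 < x := by linarith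
  have hab : a * b ≤ 1 / x ^ 3 := by nlinarith [sq_nonneg (a - b)]
  have hab0 : 0 ≤ a * b := mul_nonneg ha0 hb0
  set t := 1 / x ^ 3 with ht
  have ht0 : 0 < t := by positivity
  have hxt : x * t = 1 / x ^ 2 := by rw [ht]; field_simp
  have ht2 : t ≤ 1 / x ^ 2 := by rw [← hxt]; nlinarith
  have ht1 : t ≤ 1 := by
    rw [ht]; apply (div_le_one (by positivity)).2; exact one_le_pow₀ hx
  have p1 : a ^ 4 ≤ t * t := by
    have := mul_le_mul ha ha (sq_nonneg _) ht0.le; nlinarith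
  have p2 : a ^ 3 * b ≤ t * t := by
    have := mul_le_mul ha hab hab0 ht0.le; nlinarith
  have p3 : a ^ 2 * b ^ 2 ≤ t * t := mul_le_mul ha hb (sq_nonneg _) ht0.le
  have p4 : a * b ^ 3 ≤ t * t := by
    have := mul_le_mul hab hb (sq_nonneg _) ht0.le; nlinarith
  have p5 : b ^ 4 ≤ t * t := by
    have := mul_le_mul hb hb (sq_nonneg _) ht0.le; nlinarith
  have htt : t * t ≤ t := by nlinarith
  calc _ ≤ |2 * x * s * (a ^ 2 + a * b + b ^ 2)| + |3 / 4 * (a ^ 4 + a ^ 3 * b + a ^ 2 * b ^ 2 + a * b ^ 3 + b ^ 4)| := abs_add_le _ _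
    _ = 2 * x * (a ^ 2 + a * b + b ^ 2) + 3 / 4 * (a ^ 4 + a ^ 3 * b + a ^ 2 * b ^ 2 + a * b ^ 3 + b ^ 4) := by
        rw [abs_mul, abs_mul, hs, mul_one, abs_of_pos (by positivity : (0 : ℝ) < 2 * x),
          abs_of_nonneg (by positivity : 0 ≤ a ^ 2 + a * b + b ^ 2), abs_of_nonneg (by positivity)]
    _ ≤ 2 * x * (3 * t) + 3 / 4 * (5 * t) := by
        have : 2 * x * (a ^ 2 + a * b + b ^ 2) ≤ 2 * x * (3 * t) :=
          mul_le_mul_of_nonneg_left (by linarith) (by positivity)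
        linarith
    _ ≤ 6 * (1 / x ^ 2) + 15 / 4 * (1 / x ^ 2) := by nlinarith
    _ ≤ 10 / x ^ 2 := by
        have : 0 < 1 / x ^ 2 := by positivity
        have h : 10 / x ^ 2 = 10 * (1 / x ^ 2) := by ring
        rw [h]; linarith

lemma uniq_pos {α K : ℝ} {q₁ q₂ : ℝ → ℝ} {X s : ℝ}
    (hq₁ : ContDiffOn ℝ (⊤ : ℕ∞) q₁ (Ioi X)) (he₁ : ∀ x ∈ Ioi X, PIVEq α q₁ x)
    (hq₂ : ContDiffOn ℝ (⊤ : ℕ∞) q₂ (Ioi X)) (he₂ : ∀ x ∈ Ioi X, PIVEq α q₂ x)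
    (hs : s ^ 2 = 1) (hp₁ : ∀ x, X < x → 0 < s * q₁ x) (hp₂ : ∀ x, X < x → 0 < s * q₂ x)
    (hl₁ : Tendsto (fun x => q₁ x / pivP α x) atTop (nhds K))
    (hl₂ : Tendsto (fun x => q₂ x / pivP α x) atTop (nhds K)) :
    ∀ x, X < x → q₁ x = q₂ x := by
  have hsabs : |s| = 1 := by
    rcases sq_eq_one_iff.1 hs with rfl | rfl <;> simp
  obtain ⟨u₁', hu₁⟩ := sqrt_subst hq₁ he₁ hs hp₁
  obtain ⟨u₂', hu₂⟩ := sqrt_subst hq₂ he₂ hs hp₂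
  set u₁ : ℝ → ℝ := fun x => √(s * q₁ x) with hu₁d
  set u₂ : ℝ → ℝ := fun x => √(s * q₂ x) with hu₂d
  set N : ℝ → ℝ := fun x => 2 * x * s * (u₁ x ^ 2 + u₁ x * u₂ x + u₂ x ^ 2) +
      3 / 4 * (u₁ x ^ 4 + u₁ x ^ 3 * u₂ x + u₁ x ^ 2 * u₂ x ^ 2 + u₁ x * u₂ x ^ 3 + u₂ x ^ 4)
    with hN
  set d : ℝ → ℝ := fun x => u₁ x - u₂ x with hd
  set e : ℝ → ℝ := fun x => u₁' x - u₂' x with he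
  have hdd : ∀ x, X < x → HasDerivAt d (e x) x := fun x hx => (hu₁ x hx).1.sub (hu₂ x hx).1
  have hed : ∀ x, X < x → HasDerivAt e ((x ^ 2 - 2 * α + N x) * d x) x := by
    intro x hx
    refine ((hu₁ x hx).2.sub (hu₂ x hx).2).congr_deriv ?_
    simp only [hN, hd, hu₁d, hu₂d]
    ring
  have hqsmall : ∀ q : ℝ → ℝ, Tendsto (fun x => q x / pivP α x) atTop (nhds K) →
      ∀ᶠ x in atTop, s * q x ≤ 1 / x ^ 3 := by
    intro q hl
    have h1 := (hl.mul (pivP_decay α 3)).const_mul s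
    rw [mul_zero, mul_zero] at h1
    filter_upwards [h1.eventually (gt_mem_nhds one_pos), eventually_gt_atTop 0] with x hx hx0
    have hP := (pivP_pos α hx0).ne'
    rw [le_div_iff₀ (by positivity)]
    have : s * (q x / pivP α x * (x ^ 3 * pivP α x)) = s * q x * x ^ 3 := by
      field_simp
    linarith
  have hNb : ∀ᶠ x in atTop, |N x| ≤ 10 / x ^ 2 := by
    filter_upwards [hqsmall q₁ hl₁, hqsmall q₂ hl₂, eventually_ge_atTop 1,
      eventually_gt_atTop X] with x h1 h2 h3 h4
    apply pivN_bound x s (u₁ x) (u₂ x) h3 hsabs (Real.sqrt_nonneg _) (Real.sqrt_nonneg _)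
    · rw [hu₁d]; simp only; rw [Real.sq_sqrt (hp₁ x h4).le]; exact h1
    · rw [hu₂d]; simp only; rw [Real.sq_sqrt (hp₂ x h4).le]; exact h2
  set φ : ℝ → ℝ := fun x => √(pivP α x) with hφ
  have hφpos : ∀ x, 0 < x → 0 < φ x := fun x hx => Real.sqrt_pos.2 (pivP_pos α hx)
  have hφd : ∀ x, 0 < x → HasDerivAt φ (-(pivA α x / 2 * φ x)) x := by
    intro x hx
    refine ((pivP_deriv α hx).sqrt (pivP_pos α hx).ne').congr_deriv ?_
    have h1 : φ x ^ 2 = pivP α x := Real.sq_sqrt (pivP_pos α hx).le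
    have h2 := hφpos x hx
    change -(pivA α x * pivP α x) / (2 * φ x) = _
    rw [← h1]
    field_simp
  set β := 2 * α - 1 with hβ
  set c := β / 2 - β ^ 2 / 4 with hc
  have hlim : Tendsto (fun x => d x / φ x) atTop (nhds 0) := by
    have h1 := (hl₁.const_mul s).sqrt
    have h2 := (hl₂.const_mul s).sqrt
    have h3 := h1.sub h2
    rw [sub_self] at h3
    refine h3.congr' ?_
    filter_upwards [eventually_gt_atTop 0] with x hx
    have hP := (pivP_pos α hx).le
    simp only [hd, hφ, hu₁d, hu₂d]
    rw [sub_div, ← Real.sqrt_div' _ hP, ← Real.sqrt_div' _ hP, mul_div_assoc, mul_div_assoc]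
  obtain ⟨Z₀, hZ₀⟩ := eventually_atTop.1 hNb
  set Z := max (max X Z₀) (max 1 (|β| + 1)) with hZ
  have hZX : X ≤ Z := (le_max_left _ _).trans (le_max_left _ _)
  have hZZ : Z₀ ≤ Z := (le_max_right _ _).trans (le_max_left _ _)
  have hZ1 : 1 ≤ Z := (le_max_left _ _).trans (le_max_right _ _)
  have hZβ : |β| + 1 ≤ Z := (le_max_right _ _).trans (le_max_right _ _)
  obtain ⟨Y, hY, hY0⟩ := lin_inf (fun x => d x / φ x)
    (fun x => (e x + pivA α x / 2 * d x) / φ x) (pivA α) (fun x => N x + c / x ^ 2)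
    (10 + |c|) Z
    (by
      intro x hx
      have hx0 : 0 < x := by linarith
      have hf := hφpos x hx0
      refine ((hdd x (by linarith)).div (hφd x hx0) hf.ne').congr_deriv ?_
      field_simp
      ring)
    (by
      intro x hx
      have hx0 : 0 < x := by linarith
      have hf := hφpos x hx0
      refine (((hed x (by linarith)).add (((pivA_deriv α hx0).div_const 2).mul
        (hdd x (by linarith)))).div (hφd x hx0) hf.ne').congr_deriv ?_
      simp only [hc, pivA, ← hβ, Pi.add_apply, Pi.mul_apply]
      have hα : α = (β + 1) / 2 := by rw [hβ]; ring
      rw [hα]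
      field_simp
      ring)
    (by
      intro x hx
      have hx0 : 0 < x := by linarith
      calc |N x + c / x ^ 2| ≤ |N x| + |c / x ^ 2| := abs_add_le _ _
        _ ≤ 10 / x ^ 2 + |c| / x ^ 2 := by
          rw [abs_div, abs_of_pos (by positivity : 0 < x ^ 2)]
          linarith [hZ₀ x (by linarith)]
        _ = _ := by ring)
    (by
      intro x hx
      have hx0 : 0 < x := by linarith
      simp only [pivA, ← hβ]
      have : β / x ≤ x := by
        rw [div_le_iff₀ hx0]
        nlinarith [le_abs_self β]
      linarith)
    hlim
  have hdY : ∀ x, Y < x → d x = 0 := by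
    intro x hx
    have := hY0 x hx
    have hf := hφpos x (by linarith)
    rcases div_eq_zero_iff.1 this with h | h
    · exact h
    · exact absurd h hf.ne'
  have hd0 : ∀ x, X < x → d x = 0 := by
    intro x hx
    set b := max x (Y + 1) with hb
    have hbY : Y < b := lt_of_lt_of_le (by linarith) (le_max_right _ _)
    have heb : e b = 0 := by
      have h1 := hdd b (by linarith)
      have h2 : HasDerivAt d 0 b := by
        refine (hasDerivAt_const b (0 : ℝ)).congr_of_eventuallyEq ?_
        filter_upwards [Ioi_mem_nhds hbY] with t ht
        exact hdY t ht
      exact h1.unique h2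
    refine lin_back d e (fun x => x ^ 2 - 2 * α + N x) X x b hx (le_max_left _ _) hdd hed ?_
      (hdY b hbY) heb
    have hc1 : ContinuousOn u₁ (Icc x b) := fun t ht =>
      (hu₁ t (lt_of_lt_of_le hx ht.1)).1.continuousAt.continuousWithinAt
    have hc2 : ContinuousOn u₂ (Icc x b) := fun t ht =>
      (hu₂ t (lt_of_lt_of_le hx ht.1)).1.continuousAt.continuousWithinAt
    simp only [hN]
    fun_prop
  intro x hx
  have h := hd0 x hx
  have h1 : u₁ x = u₂ x := sub_eq_zero.1 h
  have h2 : s * q₁ x = s * q₂ x := by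
    rw [← Real.sq_sqrt (hp₁ x hx).le, ← Real.sq_sqrt (hp₂ x hx).le]
    exact congrArg (· ^ 2) h1
  have hs0 : s ≠ 0 := by rintro rfl; norm_num at hs
  exact mul_left_cancel₀ hs0 h2

lemma exists_sign (κ : ℝ) (hκ : κ ≠ 0) : ∃ s : ℝ, s ^ 2 = 1 ∧ 0 < s * κ := by
  rcases lt_or_gt_of_ne hκ with h | h
  · exact ⟨-1, by norm_num, by linarith⟩
  · exact ⟨1, by norm_num, by linarith⟩

lemma piv_unique (α κ : ℝ) : ∀ X₁ X₂ : ℝ, ∀ q₁ q₂ : ℝ → ℝ,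
      ContDiffOn ℝ (⊤ : ℕ∞) q₁ (Ioi X₁) → (∀ x ∈ Ioi X₁, PIVEq α q₁ x) →
        CMAsymp α κ q₁ →
      ContDiffOn ℝ (⊤ : ℕ∞) q₂ (Ioi X₂) → (∀ x ∈ Ioi X₂, PIVEq α q₂ x) →
        CMAsymp α κ q₂ →
      ∀ x : ℝ, max X₁ X₂ < x → q₁ x = q₂ x := by
  intro X₁ X₂ q₁ q₂ hq₁ he₁ hc₁ hq₂ he₂ hc₂ x hx
  by_cases hκ : κ = 0
  · subst hκ
    have key : ∀ (X : ℝ) (q : ℝ → ℝ), ContDiffOn ℝ (⊤ : ℕ∞) q (Ioi X) →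
        (∀ x ∈ Ioi X, PIVEq α q x) → CMAsymp α 0 q → ∀ x, X < x → q x = 0 := by
      intro X q hq he hc x hx
      obtain ⟨E, -, hE⟩ := hc
      obtain ⟨b, hb, hbX⟩ := (hE.and (eventually_gt_atTop X)).exists
      exact zero_dichotomy hq he hbX hx (by simpa using hb)
    rw [key X₁ q₁ hq₁ he₁ hc₁ x ((le_max_left _ _).trans_lt hx),
      key X₂ q₂ hq₂ he₂ hc₂ x ((le_max_right _ _).trans_lt hx)]
  · obtain ⟨s, hs, hsκ⟩ := exists_sign κ hκ
    have hs0 : s ≠ 0 := by rintro rfl; norm_num at hs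
    have key : ∀ (X : ℝ) (q : ℝ → ℝ), ContDiffOn ℝ (⊤ : ℕ∞) q (Ioi X) →
        (∀ x ∈ Ioi X, PIVEq α q x) → CMAsymp α κ q → ∀ x, X < x → 0 < s * q x := by
      intro X q hq he hc
      have hl := (cm_limit hc).const_mul s
      have hpos : 0 < s * (κ * (2 : ℝ) ^ (α - 1 / 2)) := by
        rw [← mul_assoc]; positivity
      have hev : ∀ᶠ x in atTop, 0 < s * q x := by
        filter_upwards [hl.eventually (lt_mem_nhds hpos), eventually_gt_atTop 0] with y hy hy0
        have hP := pivP_pos α hy0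
        have : s * q y = s * (q y / pivP α y) * pivP α y := by field_simp
        rw [this]
        positivity
      refine sign_const hq.continuousOn hs0 ?_ hev
      intro y hy hy0
      obtain ⟨z, hz, hzX⟩ := (hev.and (eventually_gt_atTop X)).exists
      rw [zero_dichotomy hq he hy hzX hy0] at hz
      simp at hz
    have hm₁ : Ioi (max X₁ X₂) ⊆ Ioi X₁ := Ioi_subset_Ioi (le_max_left _ _)
    have hm₂ : Ioi (max X₁ X₂) ⊆ Ioi X₂ := Ioi_subset_Ioi (le_max_right _ _)
    exact uniq_pos (hq₁.mono hm₁) (fun y hy => he₁ y (hm₁ hy)) (hq₂.mono hm₂)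
      (fun y hy => he₂ y (hm₂ hy)) hs (fun y hy => key X₁ q₁ hq₁ he₁ hc₁ y (hm₁ hy))
      (fun y hy => key X₂ q₂ hq₂ he₂ hc₂ y (hm₂ hy)) (cm_limit hc₁) (cm_limit hc₂) x hx


/-! ### Existence -/

lemma cube_integrable {x : ℝ} (hx : 0 < x) (B : ℝ) :
    IntegrableOn (fun t : ℝ => B / t ^ 3) (Ioi x) ∧ ∫ t in Ioi x, B / t ^ 3 = B / (2 * x ^ 2) := by
  have e : ∀ t ∈ Ioi x, B * t ^ (-3 : ℝ) = B / t ^ 3 := by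
    intro t ht
    have ht0 : 0 < t := hx.trans ht
    rw [Real.rpow_neg ht0.le, div_eq_mul_inv]
    norm_cast
  constructor
  · have h : IntegrableOn (fun t : ℝ => B * t ^ (-3 : ℝ)) (Ioi x) :=
      (integrableOn_Ioi_rpow_of_lt (by norm_num : (-3 : ℝ) < -1) hx).const_mul B
    exact h.congr_fun e measurableSet_Ioi
  · rw [← setIntegral_congr_fun measurableSet_Ioi e, integral_const_mul,
      integral_Ioi_rpow_of_lt (by norm_num : (-3 : ℝ) < -1) hx]
    have : x ^ (-3 + 1 : ℝ) = (x ^ 2)⁻¹ := by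
      rw [show (-3 + 1 : ℝ) = -2 by norm_num, Real.rpow_neg hx.le]
      norm_cast
    rw [this]
    field_simp
    norm_num

def opG (P : ℝ → ℝ) (X x : ℝ) : ℝ := ∫ t in X..x, 1 / P t

def opB (P : ℝ → ℝ) (X : ℝ) (g : ℝ → ℝ) (x : ℝ) : ℝ :=
  (∫ t in Ioi X, P t * g t) - ∫ t in X..x, P t * g t

def opA (P : ℝ → ℝ) (X : ℝ) (g : ℝ → ℝ) (x : ℝ) : ℝ :=
  (∫ t in Ioi X, P t * opG P X t * g t) - ∫ t in X..x, P t * opG P X t * g t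

def opS (P : ℝ → ℝ) (X : ℝ) (g : ℝ → ℝ) (x : ℝ) : ℝ := opA P X g x - opG P X x * opB P X g x

section op

variable {P a g : ℝ → ℝ} {X : ℝ}

lemma opG_deriv (hPc : Continuous P) (hPpos : ∀ x, 0 < P x) (x : ℝ) :
    HasDerivAt (opG P X) (1 / P x) x := by
  have hc : Continuous (fun t => 1 / P t) := continuous_const.div hPc fun t => (hPpos t).ne'
  exact intervalIntegral.integral_hasDerivAt_right (hc.intervalIntegrable _ _)
    (hc.stronglyMeasurableAtFilter _ _) hc.continuousAt

lemma opG_cont (hPc : Continuous P) (hPpos : ∀ x, 0 < P x) : Continuous (opG P X) :=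
  continuous_iff_continuousAt.2 fun x => (opG_deriv hPc hPpos x).continuousAt

lemma opB_deriv (hPc : Continuous P) (hg : Continuous g) (x : ℝ) :
    HasDerivAt (opB P X g) (-(P x * g x)) x := by
  have hc : Continuous (fun t => P t * g t) := hPc.mul hg
  exact (intervalIntegral.integral_hasDerivAt_right (hc.intervalIntegrable _ _)
    (hc.stronglyMeasurableAtFilter _ _) hc.continuousAt).const_sub _

lemma opS_deriv (hPc : Continuous P) (hPpos : ∀ x, 0 < P x) (hg : Continuous g) (x : ℝ) :
    HasDerivAt (opS P X g) (-(opB P X g x / P x)) x := by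
  have hc : Continuous (fun t => P t * opG P X t * g t) := (hPc.mul (opG_cont hPc hPpos)).mul hg
  have h1 : HasDerivAt (opA P X g) (-(P x * opG P X x * g x)) x :=
    (intervalIntegral.integral_hasDerivAt_right (hc.intervalIntegrable _ _)
    (hc.stronglyMeasurableAtFilter _ _) hc.continuousAt).const_sub _
  refine (h1.sub ((opG_deriv hPc hPpos x).mul (opB_deriv hPc hg x))).congr_deriv ?_
  ring

lemma opG_mono (hPc : Continuous P) (hPpos : ∀ x, 0 < P x) : Monotone (opG P X) := by
  apply monotone_of_hasDerivAt_nonneg (fun x => opG_deriv hPc hPpos x)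
  intro x
  have := hPpos x
  simp only [Pi.zero_apply]
  positivity

lemma opG_bound (hX : 1 ≤ X) (hPc : Continuous P) (hPpos : ∀ x, 0 < P x)
    (hPd : ∀ x, X < x → HasDerivAt P (-(a x * P x)) x) (ha : ∀ x, X < x → x + 1 / x ≤ a x)
    {x t : ℝ} (hx : X ≤ x) (ht : x ≤ t) : P t * (opG P X t - opG P X x) ≤ 1 / t := by
  have hx0 : 0 < x := by linarith
  have ht0 : 0 < t := by linarith
  have hmono : MonotoneOn (fun r => 1 / (r * P r) - opG P X r) (Ici X) := by
    apply monotoneOn_of_hasDerivWithinAt_nonneg (convex_Ici X)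
      (f' := fun r => (a r / r - 1 - 1 / r ^ 2) / P r)
    · refine ContinuousOn.sub (ContinuousOn.div continuousOn_const (by fun_prop) ?_)
        (opG_cont hPc hPpos).continuousOn
      intro r hr
      have hr0 : 0 < r := lt_of_lt_of_le (by linarith) hr
      exact (mul_pos hr0 (hPpos r)).ne'
    · intro r hr
      rw [interior_Ici] at hr
      have hr' : X < r := hr
      have hr0 : 0 < r := by linarith
      have hp := hPpos r
      have h := ((hasDerivAt_const r (1 : ℝ)).div ((hasDerivAt_id r).mul (hPd r hr))
        (mul_pos hr0 hp).ne').sub (opG_deriv (X := X) hPc hPpos r)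
      refine (h.congr_deriv ?_).hasDerivWithinAt
      simp only [Pi.mul_apply, id]
      field_simp
      ring
    · intro r hr
      rw [interior_Ici] at hr
      have hr' : X < r := hr
      have hr0 : 0 < r := by linarith
      have hp := hPpos r
      have h := ha r hr
      have h1 : a r / r - 1 - 1 / r ^ 2 = (a r - (r + 1 / r)) / r := by field_simp; ring
      rw [h1]
      exact div_nonneg (div_nonneg (by linarith) hr0.le) hp.le
  have h := hmono (show x ∈ Ici X from hx) (show t ∈ Ici X from hx.trans ht) ht
  simp only at h
  have hp := hPpos t
  have h1 : 0 < 1 / (x * P x) := by have := hPpos x; positivity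
  have h2 : opG P X t - opG P X x ≤ 1 / (t * P t) := by linarith
  calc P t * (opG P X t - opG P X x) ≤ P t * (1 / (t * P t)) := mul_le_mul_of_nonneg_left h2 hp.le
    _ = 1 / t := by field_simp

lemma op_integrable (hX : 1 ≤ X) (hPc : Continuous P) (hPpos : ∀ x, 0 < P x)
    (hPd : ∀ x, X < x → HasDerivAt P (-(a x * P x)) x) (ha : ∀ x, X < x → x + 1 / x ≤ a x)
    (hPi : ∀ x, X < x → x * P x ≤ 1) (hg : Continuous g) {B : ℝ}
    (hgB : ∀ x, X < x → |g x| ≤ B / x ^ 2) :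
    IntegrableOn (fun t => P t * opG P X t * g t) (Ioi X) ∧
    IntegrableOn (fun t => P t * g t) (Ioi X) := by
  have hG0 : opG P X X = 0 := by simp [opG]
  have key : ∀ h : ℝ → ℝ, Continuous h → (∀ x, X < x → 0 ≤ h x ∧ h x ≤ 1 / x) →
      IntegrableOn (fun t => h t * g t) (Ioi X) := by
    intro h hc hb
    refine ((cube_integrable (by linarith : 0 < X) B).1).mono'
      (hc.mul hg).aestronglyMeasurable ?_
    refine (ae_restrict_iff' measurableSet_Ioi).2 (Eventually.of_forall ?_)
    intro t ht
    have ht' : X < t := ht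
    have ht0 : 0 < t := by linarith
    rw [Real.norm_eq_abs, abs_mul, abs_of_nonneg (hb t ht).1]
    calc h t * |g t| ≤ 1 / t * (B / t ^ 2) :=
          mul_le_mul (hb t ht).2 (hgB t ht) (abs_nonneg _) (by positivity)
      _ = B / t ^ 3 := by field_simp
  constructor
  · refine key (fun t => P t * opG P X t) (hPc.mul (opG_cont hPc hPpos)) ?_
    intro x hx
    have h1 := opG_bound hX hPc hPpos hPd ha le_rfl hx.le
    have h2 := opG_mono (X := X) hPc hPpos hx.le
    rw [hG0] at h1 h2
    rw [sub_zero] at h1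
    exact ⟨mul_nonneg (hPpos x).le h2, h1⟩
  · refine key P hPc ?_
    intro x hx
    have hx0 : 0 < x := by linarith
    refine ⟨(hPpos x).le, ?_⟩
    rw [le_div_iff₀ hx0]
    linarith [hPi x hx]

lemma opS_bound (hX : 1 ≤ X) (hPc : Continuous P) (hPpos : ∀ x, 0 < P x)
    (hPd : ∀ x, X < x → HasDerivAt P (-(a x * P x)) x) (ha : ∀ x, X < x → x + 1 / x ≤ a x)
    (hPi : ∀ x, X < x → x * P x ≤ 1) (hg : Continuous g) {B : ℝ}
    (hgB : ∀ x, X < x → |g x| ≤ B / x ^ 2) {x : ℝ} (hx : X ≤ x) :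
    |opS P X g x| ≤ B / (2 * x ^ 2) := by
  have hx0 : 0 < x := by linarith
  obtain ⟨i1, i2⟩ := op_integrable hX hPc hPpos hPd ha hPi hg hgB
  have hsub : Ioi x ⊆ Ioi X := Ioi_subset_Ioi hx
  have tail : ∀ h : ℝ → ℝ, IntegrableOn h (Ioi X) →
      (∫ t in Ioi X, h t) - ∫ t in X..x, h t = ∫ t in Ioi x, h t := by
    intro h hi
    have := intervalIntegral.integral_interval_add_Ioi hi (hi.mono_set hsub)
    linarith
  have e : opS P X g x = ∫ t in Ioi x, P t * (opG P X t - opG P X x) * g t := by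
    unfold opS opA opB
    rw [tail _ i1, tail _ i2,
      ← integral_const_mul, ← integral_sub (i1.mono_set hsub) ((i2.mono_set hsub).const_mul _)]
    congr 1
    ext t
    ring
  rw [e, ← (cube_integrable hx0 B).2, ← Real.norm_eq_abs]
  apply norm_integral_le_of_norm_le (cube_integrable hx0 B).1
  refine (ae_restrict_iff' measurableSet_Ioi).2 (Eventually.of_forall ?_)
  intro t ht
  have ht' : x < t := ht
  have ht0 : 0 < t := by linarith
  have h1 := opG_bound hX hPc hPpos hPd ha hx ht'.le
  have h2 := opG_mono (X := X) hPc hPpos ht'.le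
  have h3 : 0 ≤ P t * (opG P X t - opG P X x) := mul_nonneg (hPpos t).le (by linarith)
  rw [Real.norm_eq_abs, abs_mul, abs_of_nonneg h3]
  calc _ ≤ 1 / t * (B / t ^ 2) :=
        mul_le_mul h1 (hgB t (by linarith)) (abs_nonneg _) (by positivity)
    _ = B / t ^ 3 := by field_simp

lemma opS_sub (hX : 1 ≤ X) (hPc : Continuous P) (hPpos : ∀ x, 0 < P x)
    (hPd : ∀ x, X < x → HasDerivAt P (-(a x * P x)) x) (ha : ∀ x, X < x → x + 1 / x ≤ a x)
    (hPi : ∀ x, X < x → x * P x ≤ 1) {g₁ g₂ : ℝ → ℝ} (hg₁ : Continuous g₁) (hg₂ : Continuous g₂)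
    {B : ℝ} (hgB₁ : ∀ x, X < x → |g₁ x| ≤ B / x ^ 2) (hgB₂ : ∀ x, X < x → |g₂ x| ≤ B / x ^ 2)
    (x : ℝ) : opS P X g₁ x - opS P X g₂ x = opS P X (fun t => g₁ t - g₂ t) x := by
  obtain ⟨i1, i2⟩ := op_integrable hX hPc hPpos hPd ha hPi hg₁ hgB₁
  obtain ⟨j1, j2⟩ := op_integrable hX hPc hPpos hPd ha hPi hg₂ hgB₂
  have hG := opG_cont (X := X) hPc hPpos
  have k1 : ∀ g : ℝ → ℝ, Continuous g →
      IntervalIntegrable (fun t => P t * opG P X t * g t) volume X x := fun g hg =>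
    ((hPc.mul hG).mul hg).intervalIntegrable _ _
  have k2 : ∀ g : ℝ → ℝ, Continuous g →
      IntervalIntegrable (fun t => P t * g t) volume X x := fun g hg =>
    (hPc.mul hg).intervalIntegrable _ _
  unfold opS opA opB
  simp only [mul_sub]
  rw [integral_sub i1 j1, integral_sub i2 j2,
    intervalIntegral.integral_sub (k1 g₁ hg₁) (k1 g₂ hg₂),
    intervalIntegral.integral_sub (k2 g₁ hg₁) (k2 g₂ hg₂)]
  ring

lemma exist_abs (hX : 1 ≤ X) (hPc : Continuous P) (hPpos : ∀ x, 0 < P x)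
    (hPd : ∀ x, X < x → HasDerivAt P (-(a x * P x)) x) (ha : ∀ x, X < x → x + 1 / x ≤ a x)
    (hPi : ∀ x, X < x → x * P x ≤ 1) (f : ℝ → ℝ → ℝ) (hf : Continuous (Function.uncurry f))
    (k M L : ℝ) (hM : 0 ≤ M) (hL : 0 ≤ L) (hLX : L ≤ X ^ 2)
    (hfM : ∀ x v, X < x → |f x v| ≤ M / x ^ 2)
    (hfL : ∀ x v w, X < x → |f x v - f x w| ≤ L / x ^ 2 * |v - w|) :
    ∃ v y : ℝ → ℝ, (∀ x, X < x → HasDerivAt v (y x) x) ∧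
      (∀ x, X < x → HasDerivAt y (a x * y x + f x (v x)) x) ∧
      ∀ x, X < x → |v x - k| ≤ M / (2 * x ^ 2) := by
  have hfc : ∀ v : BoundedContinuousFunction ℝ ℝ, Continuous (fun t => f t (v t)) := fun v =>
    hf.comp (continuous_id.prodMk v.continuous)
  have hX0 : 0 < X := by linarith
  have hb : ∀ (v : BoundedContinuousFunction ℝ ℝ) (x : ℝ), X ≤ x →
      |opS P X (fun t => f t (v t)) x| ≤ M / (2 * x ^ 2) := fun v x hx =>
    opS_bound hX hPc hPpos hPd ha hPi (hfc v) (fun t ht => hfM t _ ht) hx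
  let T : BoundedContinuousFunction ℝ ℝ → BoundedContinuousFunction ℝ ℝ := fun v =>
    BoundedContinuousFunction.ofNormedAddCommGroup
      (fun x => k + opS P X (fun t => f t (v t)) (max x X))
      (by
        have : Continuous (opS P X (fun t => f t (v t))) :=
          continuous_iff_continuousAt.2 fun x =>
            (opS_deriv hPc hPpos (hfc v) x).continuousAt
        exact continuous_const.add (this.comp (continuous_id.max continuous_const)))
      (|k| + M)
      (by
        intro x
        have hm : X ≤ max x X := le_max_right _ _
        rw [Real.norm_eq_abs]
        refine (abs_add_le _ _).trans (add_le_add le_rfl ((hb v _ hm).trans ?_))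
        apply div_le_self hM
        nlinarith)
  have hTc : ContractingWith (1 / 2) T := by
    refine ⟨by rw [← NNReal.coe_lt_coe]; norm_num, LipschitzWith.of_dist_le_mul ?_⟩
    intro v w
    rw [BoundedContinuousFunction.dist_le (by positivity)]
    intro x
    have hm : X ≤ max x X := le_max_right _ _
    change dist (k + opS P X (fun t => f t (v t)) (max x X))
      (k + opS P X (fun t => f t (w t)) (max x X)) ≤ _
    rw [dist_add_left, Real.dist_eq, opS_sub hX hPc hPpos hPd ha hPi (hfc v) (hfc w)
      (fun t ht => hfM t _ ht) (fun t ht => hfM t _ ht)]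
    have h1 := opS_bound (B := L * dist v w) hX hPc hPpos hPd ha hPi ((hfc v).sub (hfc w))
      (fun t ht => by
        have h2 := hfL t (v t) (w t) ht
        have h3 : |v t - w t| ≤ dist v w := by
          rw [← Real.dist_eq]; exact BoundedContinuousFunction.dist_coe_le_dist t
        calc |f t (v t) - f t (w t)| ≤ L / t ^ 2 * |v t - w t| := h2
          _ ≤ L / t ^ 2 * dist v w := mul_le_mul_of_nonneg_left h3 (by positivity)
          _ = L * dist v w / t ^ 2 := by ring) hm
    refine h1.trans ?_
    have hm2 : X ^ 2 ≤ (max x X) ^ 2 := pow_le_pow_left₀ hX0.le hm 2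
    have hd : 0 ≤ dist v w := dist_nonneg
    rw [div_le_iff₀ (by positivity)]
    have h5 : L * dist v w ≤ (max x X) ^ 2 * dist v w :=
      mul_le_mul_of_nonneg_right (hLX.trans hm2) hd
    push_cast
    linarith
  let v := ContractingWith.fixedPoint T hTc
  have hv : T v = v := hTc.fixedPoint_isFixedPt
  have hvx : ∀ x, X < x → v x = k + opS P X (fun t => f t (v t)) x := by
    intro x hx
    have h : T v x = v x := by rw [hv]
    rw [← h]
    change k + opS P X (fun t => f t (v t)) (max x X) = _
    rw [max_eq_left hx.le]
  refine ⟨v, fun x => -(opB P X (fun t => f t (v t)) x / P x), ?_, ?_, ?_⟩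
  · intro x hx
    refine ((opS_deriv hPc hPpos (hfc v) x).const_add k).congr_of_eventuallyEq ?_
    filter_upwards [Ioi_mem_nhds hx] with t ht
    exact hvx t ht
  · intro x hx
    have hp := hPpos x
    refine ((opB_deriv hPc (hfc v) x).div (hPd x hx) hp.ne').neg.congr_deriv ?_
    field_simp
    ring
  · intro x hx
    rw [hvx x hx, add_sub_cancel_left]
    exact hb v x hx.le

end op

/-- The regular nonlinearity for the reduced unknown. -/
def pivF (c s m p v : ℝ) : ℝ := c / m ^ 2 * v + 2 * m * s * p * v ^ 3 + 3 / 4 * p ^ 2 * v ^ 5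

lemma pivF_coef {s m p : ℝ} (hs : |s| = 1) (hm : 1 ≤ m) (hp : 0 < p) (hmp : m ^ 3 * p ≤ 1) :
    |2 * m * s * p| ≤ 2 / m ^ 2 ∧ |3 / 4 * p ^ 2| ≤ 3 / 4 / m ^ 2 := by
  have hm0 : 0 < m := by linarith
  constructor
  · rw [abs_mul, abs_mul, hs, abs_of_pos hp, abs_of_pos (by positivity : 0 < 2 * m),
      le_div_iff₀ (by positivity)]
    nlinarith
  · rw [abs_of_pos (by positivity), le_div_iff₀ (by positivity)]
    have h1 : 0 ≤ m ^ 3 * p := by positivity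
    have h2 : (m ^ 3 * p) ^ 2 ≤ 1 := by nlinarith
    have h3 : p ^ 2 * m ^ 2 ≤ (m ^ 3 * p) ^ 2 := by
      have : 1 ≤ m ^ 4 := one_le_pow₀ hm
      have h4 : 0 ≤ p ^ 2 * m ^ 2 := by positivity
      have : (m ^ 3 * p) ^ 2 = m ^ 4 * (p ^ 2 * m ^ 2) := by ring
      rw [this]; nlinarith
    linarith

lemma pivF_bound {c s m p v R : ℝ} (hs : |s| = 1) (hm : 1 ≤ m) (hp : 0 < p)
    (hmp : m ^ 3 * p ≤ 1) (hv : |v| ≤ R) :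
    |pivF c s m p v| ≤ (|c| * R + 2 * R ^ 3 + 3 / 4 * R ^ 5) / m ^ 2 := by
  obtain ⟨h1, h2⟩ := pivF_coef hs hm hp hmp
  have hm0 : 0 < m := by linarith
  have e3 : |v ^ 3| ≤ R ^ 3 := by rw [abs_pow]; exact pow_le_pow_left₀ (abs_nonneg _) hv 3
  have e5 : |v ^ 5| ≤ R ^ 5 := by rw [abs_pow]; exact pow_le_pow_left₀ (abs_nonneg _) hv 5
  have h0 : |c / m ^ 2| = |c| / m ^ 2 := by rw [abs_div, abs_of_pos (by positivity : 0 < m ^ 2)]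
  unfold pivF
  calc _ ≤ |c / m ^ 2 * v| + |2 * m * s * p * v ^ 3| + |3 / 4 * p ^ 2 * v ^ 5| :=
        abs_add_three _ _ _
    _ ≤ |c| / m ^ 2 * R + 2 / m ^ 2 * R ^ 3 + 3 / 4 / m ^ 2 * R ^ 5 := by
        rw [abs_mul (c / m ^ 2), abs_mul (2 * m * s * p), abs_mul (3 / 4 * p ^ 2), h0]
        gcongr
    _ = _ := by ring

lemma pivF_lip {c s m p v w R : ℝ} (hs : |s| = 1) (hm : 1 ≤ m) (hp : 0 < p)
    (hmp : m ^ 3 * p ≤ 1) (hv : |v| ≤ R) (hw : |w| ≤ R) :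
    |pivF c s m p v - pivF c s m p w| ≤
      (|c| + 6 * R ^ 2 + 15 / 4 * R ^ 4) / m ^ 2 * |v - w| := by
  obtain ⟨h1, h2⟩ := pivF_coef hs hm hp hmp
  have hm0 : 0 < m := by linarith
  have hR : 0 ≤ R := (abs_nonneg v).trans hv
  have mon : ∀ i j n : ℕ, i + j = n → |v ^ i * w ^ j| ≤ R ^ n := by
    rintro i j n rfl
    rw [abs_mul, abs_pow, abs_pow, pow_add]
    exact mul_le_mul (pow_le_pow_left₀ (abs_nonneg _) hv i) (pow_le_pow_left₀ (abs_nonneg _) hw j)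
      (by positivity) (by positivity)
  have e3 : |v ^ 3 - w ^ 3| ≤ 3 * R ^ 2 * |v - w| := by
    have : v ^ 3 - w ^ 3 = (v ^ 2 * w ^ 0 + v ^ 1 * w ^ 1 + v ^ 0 * w ^ 2) * (v - w) := by ring
    rw [this, abs_mul]
    refine mul_le_mul_of_nonneg_right ((abs_add_three _ _ _).trans ?_) (abs_nonneg _)
    linarith [mon 2 0 2 rfl, mon 1 1 2 rfl, mon 0 2 2 rfl]
  have e5 : |v ^ 5 - w ^ 5| ≤ 5 * R ^ 4 * |v - w| := by
    have : v ^ 5 - w ^ 5 = (v ^ 4 * w ^ 0 + v ^ 3 * w ^ 1 + v ^ 2 * w ^ 2 + v ^ 1 * w ^ 3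
      + v ^ 0 * w ^ 4) * (v - w) := by ring
    rw [this, abs_mul]
    refine mul_le_mul_of_nonneg_right ?_ (abs_nonneg _)
    refine (abs_add_le _ _).trans ((add_le_add_left ((abs_add_le _ _).trans
      (add_le_add_left (abs_add_three _ _ _) _)) _).trans ?_)
    linarith [mon 4 0 4 rfl, mon 3 1 4 rfl, mon 2 2 4 rfl, mon 1 3 4 rfl, mon 0 4 4 rfl]
  have h0 : |c / m ^ 2| = |c| / m ^ 2 := by rw [abs_div, abs_of_pos (by positivity : 0 < m ^ 2)]
  have e : pivF c s m p v - pivF c s m p w = c / m ^ 2 * (v - w) + 2 * m * s * p * (v ^ 3 - w ^ 3)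
      + 3 / 4 * p ^ 2 * (v ^ 5 - w ^ 5) := by unfold pivF; ring
  rw [e]
  calc _ ≤ |c / m ^ 2 * (v - w)| + |2 * m * s * p * (v ^ 3 - w ^ 3)|
        + |3 / 4 * p ^ 2 * (v ^ 5 - w ^ 5)| := abs_add_three _ _ _
    _ ≤ |c| / m ^ 2 * |v - w| + 2 / m ^ 2 * (3 * R ^ 2 * |v - w|)
        + 3 / 4 / m ^ 2 * (5 * R ^ 4 * |v - w|) := by
        rw [abs_mul (c / m ^ 2), abs_mul (2 * m * s * p), abs_mul (3 / 4 * p ^ 2), h0]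
        gcongr
    _ = _ := by ring

def clampR (R v : ℝ) : ℝ := max (-R) (min R v)

lemma clampR_abs {R : ℝ} (hR : 0 ≤ R) (v : ℝ) : |clampR R v| ≤ R :=
  abs_le.2 ⟨le_max_left _ _, max_le (by linarith) (min_le_left _ _)⟩

lemma clampR_eq {R v : ℝ} (h : |v| ≤ R) : clampR R v = v := by
  have := abs_le.1 h
  rw [clampR, min_eq_right this.2, max_eq_right this.1]

lemma clampR_lip (R v w : ℝ) : |clampR R v - clampR R w| ≤ |v - w| := by
  unfold clampR
  refine (abs_max_sub_max_le_max _ _ _ _).trans ?_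
  rw [sub_self, abs_zero]
  refine max_le (abs_nonneg _) ((abs_min_sub_min_le_max _ _ _ _).trans ?_)
  rw [sub_self, abs_zero]
  exact max_le (abs_nonneg _) le_rfl

lemma pivP_smooth (α : ℝ) : ContDiffOn ℝ (⊤ : ℕ∞) (pivP α) (Ioi 0) := by
  unfold pivP
  refine ContDiffOn.mul ?_ (by fun_prop)
  intro x hx
  exact (Real.contDiffAt_rpow_const_of_ne (ne_of_gt hx)).contDiffWithinAt

lemma exist_v (α s k : ℝ) (hs : s ^ 2 = 1) (hk : 0 < k) :
    ∃ X M : ℝ, 1 ≤ X ∧ ∃ v y : ℝ → ℝ, (∀ x, X < x → HasDerivAt v (y x) x) ∧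
      (∀ x, X < x → HasDerivAt y (pivA α x * y x +
        pivF ((2 * α - 1) / 2 - (2 * α - 1) ^ 2 / 4) s x (pivP α x) (v x)) x) ∧
      (∀ x, X < x → 0 < v x ∧ v x ≤ k + 1) ∧
      ∀ x, X < x → |v x - k| ≤ M / x ^ 2 := by
  have hsabs : |s| = 1 := by
    rcases sq_eq_one_iff.1 hs with rfl | rfl <;> simp
  set c := (2 * α - 1) / 2 - (2 * α - 1) ^ 2 / 4 with hc
  set R := k + 1 with hR
  have hR0 : 0 < R := by linarith
  set M := |c| * R + 2 * R ^ 3 + 3 / 4 * R ^ 5 with hM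
  set L := |c| + 6 * R ^ 2 + 15 / 4 * R ^ 4 with hL
  have hM0 : 0 ≤ M := by positivity
  have hL0 : 0 ≤ L := by positivity
  have hev := (pivP_decay α 3).eventually (gt_mem_nhds one_pos)
  obtain ⟨Z, hZ⟩ := eventually_atTop.1 hev
  obtain ⟨X, hX1, hXZ, hXL, hXM, hXk, hXα⟩ : ∃ X : ℝ, 1 ≤ X ∧ Z ≤ X ∧ L ≤ X ∧ M ≤ X ∧
      M / k ≤ X ∧ |2 * α| ≤ X :=
    ((eventually_ge_atTop 1).and ((eventually_ge_atTop Z).and ((eventually_ge_atTop L).and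
      ((eventually_ge_atTop M).and ((eventually_ge_atTop (M / k)).and
        (eventually_ge_atTop _)))))).exists
  have hX0 : 0 < X := by linarith
  have hX2 : X ≤ X ^ 2 := by nlinarith
  have hm1 : ∀ x : ℝ, 1 ≤ max x X := fun x => hX1.trans (le_max_right _ _)
  have hm0 : ∀ x : ℝ, 0 < max x X := fun x => by linarith [hm1 x]
  have hcontP : Continuous (fun x => pivP α (max x X)) := by
    unfold pivP
    refine Continuous.mul ?_ (by fun_prop)
    exact Continuous.rpow_const (by fun_prop) fun x => Or.inl (hm0 x).ne'
  have hev3 : ∀ x, X ≤ x → x ^ 3 * pivP α x ≤ 1 := fun x hx => (hZ x (hXZ.trans hx)).le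
  have hmax : ∀ x, X < x → max x X = x := fun x hx => max_eq_left hx.le
  obtain ⟨v, y, hv, hy, hvk⟩ := exist_abs (P := fun x => pivP α (max x X)) (a := pivA α) hX1 hcontP
    (fun x => pivP_pos α (hm0 x))
    (by
      intro x hx
      have hx0 : 0 < x := by linarith
      rw [hmax x hx]
      refine (pivP_deriv α hx0).congr_of_eventuallyEq ?_
      filter_upwards [Ioi_mem_nhds hx] with t ht
      rw [hmax t ht])
    (by
      intro x hx
      have hx0 : 0 < x := by linarith
      have h2 : 0 ≤ x - 2 * α / x := by
        have : 2 * α / x ≤ x := by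
          rw [div_le_iff₀ hx0]; nlinarith [le_abs_self (2 * α)]
        linarith
      have : pivA α x = x + 1 / x + (x - 2 * α / x) := by
        unfold pivA; field_simp; ring
      linarith)
    (by
      intro x hx
      have hx1 : 1 < x := by linarith
      have hx0 : 0 < x := by linarith
      simp only [hmax x hx]
      have h1 := hev3 x hx.le
      have hp := pivP_pos α hx0
      have : x * pivP α x ≤ x ^ 3 * pivP α x := by
        apply mul_le_mul_of_nonneg_right _ hp.le
        exact le_self_pow₀ hx1.le (by norm_num)
      linarith)
    (fun x v => pivF c s (max x X) (pivP α (max x X)) (clampR R v))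
    (by
      unfold pivF clampR
      have hcP : Continuous (fun z : ℝ × ℝ => pivP α (max z.1 X)) := hcontP.comp continuous_fst
      have hcd : Continuous (fun z : ℝ × ℝ => c / (max z.1 X) ^ 2) :=
        continuous_const.div (by fun_prop) fun z => (pow_pos (hm0 z.1) 2).ne'
      simp only [Function.uncurry_def]
      fun_prop)
    k M L hM0 hL0 (hXL.trans hX2)
    (by
      intro x v hx
      have := pivF_bound (c := c) hsabs (hm1 x) (pivP_pos α (hm0 x))
        (hev3 _ (le_max_right x X)) (clampR_abs hR0.le v)
      rw [hmax x hx] at *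
      exact this)
    (by
      intro x v w hx
      have := pivF_lip (c := c) hsabs (hm1 x) (pivP_pos α (hm0 x))
        (hev3 _ (le_max_right x X)) (clampR_abs hR0.le v) (clampR_abs hR0.le w)
      rw [hmax x hx] at *
      exact this.trans (mul_le_mul_of_nonneg_left (clampR_lip R v w) (by positivity)))
  have hvb : ∀ x, X < x → 0 < v x ∧ v x ≤ R := by
    intro x hx
    have hx0 : 0 < x := by linarith
    have hxX : X ≤ x ^ 2 := by nlinarith
    have h1 : M / (2 * x ^ 2) ≤ 1 / 2 := by
      rw [div_le_iff₀ (by positivity)]; linarith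
    have h2 : M / (2 * x ^ 2) ≤ k / 2 := by
      rw [div_le_iff₀ (by positivity)]
      have := (div_le_iff₀ hk).1 (hXk.trans hxX)
      nlinarith
    have h3 := abs_le.1 (hvk x hx)
    constructor <;> linarith
  refine ⟨X, M, hX1, v, y, hv, ?_, hvb, ?_⟩
  · intro x hx
    have h := hy x hx
    have hb := hvb x hx
    rw [clampR_eq (by rw [abs_of_pos hb.1]; exact hb.2), hmax x hx] at h
    exact h
  · intro x hx
    have hx0 : 0 < x := by linarith
    refine (hvk x hx).trans ?_
    apply div_le_div_of_nonneg_left hM0 (by positivity)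
    nlinarith [sq_nonneg x]

lemma v_smooth {α s c X : ℝ} (hX : 1 ≤ X) {v y : ℝ → ℝ}
    (hv : ∀ x, X < x → HasDerivAt v (y x) x)
    (hy : ∀ x, X < x → HasDerivAt y (pivA α x * y x + pivF c s x (pivP α x) (v x)) x) :
    ContDiffOn ℝ (⊤ : ℕ∞) v (Ioi X) := by
  have hsub : Ioi X ⊆ Ioi 0 := Ioi_subset_Ioi (by linarith)
  have hne : ∀ x ∈ Ioi X, x ≠ 0 := fun x hx => ne_of_gt (hsub hx)
  have key : ∀ n : ℕ, ContDiffOn ℝ n v (Ioi X) ∧ ContDiffOn ℝ n y (Ioi X) := by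
    intro n
    induction n with
    | zero =>
      constructor
      · exact contDiffOn_zero.2 fun x hx => (hv x hx).continuousAt.continuousWithinAt
      · exact contDiffOn_zero.2 fun x hx => (hy x hx).continuousAt.continuousWithinAt
    | succ n ih =>
      obtain ⟨iv, iy⟩ := ih
      have hP : ContDiffOn ℝ n (pivP α) (Ioi X) :=
        ((pivP_smooth α).mono hsub).of_le (by exact_mod_cast le_top)
      have hid : ContDiffOn ℝ n (fun x : ℝ => x) (Ioi X) := contDiffOn_id
      have hA : ContDiffOn ℝ n (pivA α) (Ioi X) := by
        unfold pivA
        exact (contDiffOn_const.mul hid).sub (contDiffOn_const.div hid hne)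
      have hF : ContDiffOn ℝ n (fun x => pivF c s x (pivP α x) (v x)) (Ioi X) := by
        unfold pivF
        have h1 : ContDiffOn ℝ n (fun x : ℝ => c / x ^ 2) (Ioi X) :=
          contDiffOn_const.div (hid.pow 2) fun x hx => pow_ne_zero 2 (hne x hx)
        fun_prop
      push_cast
      rw [contDiffOn_succ_iff_deriv_of_isOpen isOpen_Ioi,
        contDiffOn_succ_iff_deriv_of_isOpen isOpen_Ioi]
      refine ⟨⟨fun x hx => (hv x hx).differentiableAt.differentiableWithinAt, by simp,
        iy.congr fun x hx => (hv x hx).deriv⟩,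
        ⟨fun x hx => (hy x hx).differentiableAt.differentiableWithinAt, by simp,
        ((hA.mul iy).add hF).congr fun x hx => (hy x hx).deriv⟩⟩
  exact contDiffOn_infty.2 fun n => (key n).1

lemma piv_exists (α κ : ℝ) (hκ : κ ≠ 0) : ∃ X : ℝ, ∃ q : ℝ → ℝ,
      ContDiffOn ℝ (⊤ : ℕ∞) q (Ioi X) ∧ (∀ x ∈ Ioi X, q x ≠ 0) ∧
      (∀ x ∈ Ioi X, PIVEq α q x) ∧ CMAsymp α κ q := by
  obtain ⟨s, hs, hsκ⟩ := exists_sign κ hκ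
  have hs0 : s ≠ 0 := by rintro rfl; norm_num at hs
  have hpos : 0 < s * κ * (2 : ℝ) ^ (α - 1 / 2) := by positivity
  set k := √(s * κ * (2 : ℝ) ^ (α - 1 / 2)) with hk
  have hk0 : 0 < k := Real.sqrt_pos.2 hpos
  have hk2 : k ^ 2 = s * κ * (2 : ℝ) ^ (α - 1 / 2) := Real.sq_sqrt hpos.le
  have hsk : s * k ^ 2 = κ * (2 : ℝ) ^ (α - 1 / 2) := by
    rw [hk2]; linear_combination (κ * (2 : ℝ) ^ (α - 1 / 2)) * hs
  obtain ⟨X, M, hX, v, y, hv, hy, hvb, hvk⟩ := exist_v α s k hs hk0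
  have hsub : Ioi X ⊆ Ioi 0 := Ioi_subset_Ioi (by linarith)
  set q : ℝ → ℝ := fun x => s * pivP α x * v x ^ 2 with hq
  have hd1 : ∀ x, X < x → HasDerivAt q
      (s * pivP α x * (2 * v x * y x - pivA α x * v x ^ 2)) x := by
    intro x hx
    refine (((pivP_deriv α (hsub hx)).const_mul s).mul ((hv x hx).pow 2)).congr_deriv ?_
    simp only [Pi.pow_apply]
    push_cast
    ring
  refine ⟨X, q, ?_, ?_, ?_, ?_⟩
  · have h1 := v_smooth hX hv hy
    have h2 := (pivP_smooth α).mono hsub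
    exact (contDiffOn_const.mul h2).mul (h1.pow 2)
  · intro x hx
    exact mul_ne_zero (mul_ne_zero hs0 (pivP_pos α (hsub hx)).ne') (pow_ne_zero 2 (hvb x hx).1.ne')
  · intro x hx
    have hx0 : 0 < x := hsub hx
    have hp := pivP_pos α hx0
    have hvp := (hvb x hx).1
    unfold PIVEq
    have he : deriv q =ᶠ[nhds x]
        fun x => s * pivP α x * (2 * v x * y x - pivA α x * v x ^ 2) := by
      filter_upwards [Ioi_mem_nhds hx] with t ht
      exact (hd1 t ht).deriv
    have hd2 := ((pivP_deriv α hx0).const_mul s).mul ((((hv x hx).const_mul 2).mul (hy x hx)).sub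
      ((pivA_deriv α hx0).mul ((hv x hx).pow 2)))
    rw [he.deriv_eq, (hd1 x hx).deriv]
    refine hd2.deriv.trans ?_
    simp only [hq, Pi.mul_apply, Pi.pow_apply, Pi.sub_apply, pivA, pivF]
    generalize pivP α x = p at *
    generalize v x = V at *
    generalize y x = Y at *
    rcases sq_eq_one_iff.1 hs with rfl | rfl
    all_goals
      field_simp
      push_cast
      ring
  · refine ⟨fun x => v x ^ 2 / k ^ 2 - 1, ?_, ?_⟩
    · refine IsBigO.of_bound (M * (2 * k + 1) / k ^ 2) ?_
      filter_upwards [eventually_gt_atTop X] with x hx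
      have hx0 : 0 < x := hsub hx
      have h1 : ‖x ^ (-2 : ℝ)‖ = 1 / x ^ 2 := by
        rw [Real.norm_of_nonneg (Real.rpow_nonneg hx0.le _), Real.rpow_neg hx0.le, one_div]
        norm_cast
      rw [h1, Real.norm_eq_abs]
      have h2 : v x ^ 2 / k ^ 2 - 1 = (v x - k) * (v x + k) / k ^ 2 := by field_simp; ring
      have hb := hvb x hx
      rw [h2, abs_div, abs_mul, abs_of_pos (by linarith : 0 < v x + k),
        abs_of_pos (by positivity : 0 < k ^ 2)]
      calc |v x - k| * (v x + k) / k ^ 2 ≤ (M / x ^ 2) * (2 * k + 1) / k ^ 2 := by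
            apply div_le_div_of_nonneg_right _ (by positivity)
            exact mul_le_mul (hvk x hx) (by linarith) (by linarith)
              ((abs_nonneg _).trans (hvk x hx))
        _ = _ := by ring
    · filter_upwards with x
      rw [← hsk]
      simp only [hq, pivP]
      field_simp
      ring

theorem piv_clarkson_mcleod_exists_unique (α κ : ℝ) :
    (∃ X : ℝ, ∃ q : ℝ → ℝ,
      ContDiffOn ℝ (⊤ : ℕ∞) q (Ioi X) ∧
      (κ ≠ 0 → ∀ x ∈ Ioi X, q x ≠ 0) ∧
      (κ = 0 → ∀ x ∈ Ioi X, q x = 0) ∧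
      (∀ x ∈ Ioi X, PIVEq α q x) ∧
      CMAsymp α κ q) ∧
    ∀ X₁ X₂ : ℝ, ∀ q₁ q₂ : ℝ → ℝ,
      ContDiffOn ℝ (⊤ : ℕ∞) q₁ (Ioi X₁) → (∀ x ∈ Ioi X₁, PIVEq α q₁ x) →
        CMAsymp α κ q₁ →
      ContDiffOn ℝ (⊤ : ℕ∞) q₂ (Ioi X₂) → (∀ x ∈ Ioi X₂, PIVEq α q₂ x) →
        CMAsymp α κ q₂ →
      ∀ x : ℝ, max X₁ X₂ < x → q₁ x = q₂ x := by
  refine ⟨?_, piv_unique α κ⟩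
  by_cases hκ : κ = 0
  · refine ⟨0, fun _ => 0, contDiffOn_const, fun h => absurd hκ h, fun _ _ _ => rfl, ?_, ?_⟩
    · intro x _
      simp [PIVEq]
    · refine ⟨fun _ => 0, isBigO_zero _ _, ?_⟩
      filter_upwards with x
      simp [hκ]
  · obtain ⟨X, q, h1, h2, h3, h4⟩ := piv_exists α κ hκ
    exact ⟨X, q, h1, fun _ => h2, fun h => absurd h hκ, h3, h4⟩
end
end

section
/- Let α ∈ ℝ with α + 1/2 ∉ ℕ and let κ ∈ ℝ ∖ {0}. Then the Hamiltonian 𝓗(x;α,κ) of the Clarkson–McLeod solution q(·;α,κ) satisfies 𝓗(x;α,κ) = −κ·2^{α−1/2}·x^{2α−1}·e^{−x²}·(1+O(x^{−2})) as x → +∞. -/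
open Real Filter Set Asymptotics MeasureTheory

noncomputable section

/-- The Hamiltonian associated with a solution `q` of PIV(α):
`𝓗(x) = q³/4 + xq² + (x²-2α)q - (q')²/(4q)`. -/
def Ham (α : ℝ) (q : ℝ → ℝ) (x : ℝ) : ℝ :=
  (q x) ^ 3 / 4 + x * (q x) ^ 2 + (x ^ 2 - 2 * α) * q x - (deriv q x) ^ 2 / (4 * q x)

/-- A function whose derivative is dominated by minus that of a function tending to zero
converges, with an explicit rate. -/
lemma conv_of_dominated (F F' G G' : ℝ → ℝ) (x0 : ℝ)
    (hF : ∀ x, x0 ≤ x → HasDerivAt F (F' x) x)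
    (hG : ∀ x, x0 ≤ x → HasDerivAt G (G' x) x)
    (hle : ∀ x, x0 ≤ x → |F' x| ≤ -G' x)
    (hG0 : Tendsto G atTop (nhds 0)) :
    ∃ c, Tendsto F atTop (nhds c) ∧ ∀ x, x0 ≤ x → |F x - c| ≤ G x := by
  have anti1 : AntitoneOn (fun x => G x + F x) (Ici x0) := by
    apply antitoneOn_of_hasDerivWithinAt_nonpos (f' := fun x => G' x + F' x) (convex_Ici x0)
    · intro x hx
      exact ((hG x hx).add (hF x hx)).continuousAt.continuousWithinAt
    · intro x hx
      have hx : x0 ≤ x := interior_subset hx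
      exact ((hG x hx).add (hF x hx)).hasDerivWithinAt
    · intro x hx
      have hx : x0 ≤ x := interior_subset hx
      have := abs_le.1 (hle x hx)
      linarith
  have anti2 : AntitoneOn (fun x => G x - F x) (Ici x0) := by
    apply antitoneOn_of_hasDerivWithinAt_nonpos (f' := fun x => G' x - F' x) (convex_Ici x0)
    · intro x hx
      exact ((hG x hx).sub (hF x hx)).continuousAt.continuousWithinAt
    · intro x hx
      have hx : x0 ≤ x := interior_subset hx
      exact ((hG x hx).sub (hF x hx)).hasDerivWithinAt
    · intro x hx
      have hx : x0 ≤ x := interior_subset hx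
      have := abs_le.1 (hle x hx)
      linarith
  have key : ∀ x y, x0 ≤ x → x ≤ y → |F x - F y| ≤ G x - G y := by
    intro x y hx hxy
    have h1 := anti1 hx (hx.trans hxy : x0 ≤ y) hxy
    have h2 := anti2 hx (hx.trans hxy : x0 ≤ y) hxy
    simp only at h1 h2
    rw [abs_le]; constructor <;> linarith
  have hGnn : ∀ x, x0 ≤ x → 0 ≤ G x := by
    intro x hx
    apply le_of_tendsto hG0
    filter_upwards [eventually_ge_atTop x] with y hy
    have := (abs_nonneg _).trans (key x y hx hy)
    linarith
  have hc : CauchySeq F := by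
    rw [Metric.cauchySeq_iff']
    intro ε hε
    obtain ⟨N, hN1, hN2⟩ :=
      ((hG0.eventually (gt_mem_nhds hε)).and (eventually_ge_atTop x0)).exists
    refine ⟨N, fun n hn => ?_⟩
    rw [dist_comm, Real.dist_eq]
    have := key N n hN2 hn
    have := hGnn n (hN2.trans hn)
    linarith
  obtain ⟨c, hc⟩ := cauchySeq_tendsto_of_complete hc
  refine ⟨c, hc, fun x hx => ?_⟩
  have h1 : Tendsto (fun y => |F x - F y|) atTop (nhds |F x - c|) :=
    (tendsto_const_nhds.sub hc).abs
  have h2 : Tendsto (fun y => G x - G y) atTop (nhds (G x - 0)) := tendsto_const_nhds.sub hG0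
  rw [sub_zero] at h2
  apply le_of_tendsto_of_tendsto h1 h2
  filter_upwards [eventually_ge_atTop x] with y hy using key x y hx hy

lemma tendsto_rpow_mul_exp_neg_sq (p : ℝ) :
    Tendsto (fun x : ℝ => x ^ p * Real.exp (-x ^ 2)) atTop (nhds 0) := by
  have h := tendsto_rpow_mul_exp_neg_mul_atTop_nhds_zero p 1 one_pos
  refine squeeze_zero' ?_ ?_ h
  · filter_upwards [eventually_ge_atTop 1] with x hx
    positivity
  · filter_upwards [eventually_ge_atTop 1] with x hx
    have : Real.exp (-x ^ 2) ≤ Real.exp (-1 * x) := by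
      apply Real.exp_le_exp.2; nlinarith
    gcongr

lemma hasDerivAt_w (p x : ℝ) (hx : 0 < x) :
    HasDerivAt (fun x : ℝ => x ^ p * Real.exp (-x ^ 2))
      ((p / x - 2 * x) * (x ^ p * Real.exp (-x ^ 2))) x := by
  have h1 := Real.hasDerivAt_rpow_const (x := x) (p := p) (Or.inl hx.ne')
  have h2 : HasDerivAt (fun x : ℝ => Real.exp (-x ^ 2)) (Real.exp (-x ^ 2) * (-(2 * x))) x := by
    have := ((hasDerivAt_pow 2 x).neg).exp
    simpa using this
  refine (h1.mul h2).congr_deriv ?_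
  rw [Real.rpow_sub_one hx.ne']
  field_simp
  ring

lemma hasDerivAt_Ham (α : ℝ) (q : ℝ → ℝ) (x : ℝ) (hq : DifferentiableAt ℝ q x)
    (hq' : DifferentiableAt ℝ (deriv q) x) (h : PIVEq α q x) (h0 : q x ≠ 0) :
    HasDerivAt (Ham α q) (q x ^ 2 + 2 * x * q x) x := by
  have a := hq.hasDerivAt
  have b := hq'.hasDerivAt
  have i := hasDerivAt_id x
  have := ((((a.pow 3).div_const 4).add (i.mul (a.pow 2))).add
    (((i.pow 2).sub_const (2 * α)).mul a)).sub ((b.pow 2).div (a.const_mul 4) (by simpa using h0))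
  refine HasDerivAt.congr_deriv (f := Ham α q) this ?_
  unfold PIVEq at h
  simp only [id, Pi.pow_apply, h]
  field_simp
  push_cast
  ring

/-- If `q → 0`, `q` has no zeros and `q'^2/(4q) → d`, then `d = 0`. -/
lemma limit_zero (q : ℝ → ℝ) (x0 d : ℝ) (hq : ∀ x, x0 ≤ x → DifferentiableAt ℝ q x)
    (h0 : ∀ x, x0 ≤ x → q x ≠ 0) (hlim : Tendsto q atTop (nhds 0))
    (hd : Tendsto (fun x => deriv q x ^ 2 / (4 * q x)) atTop (nhds d)) : d = 0 := by
  by_contra hne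
  have hpos : 0 < |d| := abs_pos.2 hne
  have hu : Tendsto (fun x => √|q x|) atTop (nhds 0) := by
    have := hlim.abs.sqrt
    simpa using this
  have hu' : Tendsto (fun x => √|q (x + 1)| - √|q x|) atTop (nhds 0) := by
    have := (hu.comp (tendsto_atTop_add_const_right atTop (1 : ℝ) tendsto_id)).sub hu
    simpa using this
  have hu2 : Tendsto (fun x => (√|q (x + 1)| - √|q x|) ^ 2) atTop (nhds 0) := by
    simpa using hu'.pow 2
  have e1 := hu2.eventually (gt_mem_nhds (half_pos hpos))
  have e2 := hd.abs.eventually (lt_mem_nhds (half_lt_self hpos))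
  obtain ⟨N, hN⟩ := (e2.and (eventually_ge_atTop x0)).exists_forall_of_atTop
  obtain ⟨x, hx1, hx2⟩ := (e1.and (eventually_ge_atTop N)).exists
  have hder : ∀ y, x ≤ y → HasDerivAt (fun y => √|q y|)
      ((SignType.sign (q y) : ℝ) * deriv q y / (2 * √|q y|)) y := by
    intro y hy
    have hy0 := (hN y (hx2.trans hy)).2
    have h := (hasDerivAt_abs (h0 y hy0)).comp y (hq y hy0).hasDerivAt
    exact h.sqrt (abs_ne_zero.2 (h0 y hy0))
  obtain ⟨y, hy, hyeq⟩ := exists_hasDerivAt_eq_slope (fun y => √|q y|) _ (lt_add_one x)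
    (fun y hy => (hder y hy.1).continuousAt.continuousWithinAt)
    (fun y hy => hder y hy.1.le)
  have hyN := hN y (hx2.trans hy.1.le)
  have hqy := h0 y hyN.2
  simp only [add_sub_cancel_left, div_one] at hyeq
  rw [← hyeq] at hx1
  have hs : ((SignType.sign (q y) : ℝ)) ^ 2 = 1 := by
    rcases lt_or_gt_of_ne hqy with h | h
    · simp [sign_neg h]
    · simp [sign_pos h]
  have : ((SignType.sign (q y) : ℝ) * deriv q y / (2 * √|q y|)) ^ 2
      = |deriv q y ^ 2 / (4 * q y)| := by
    rw [div_pow, mul_pow, mul_pow, hs, Real.sq_sqrt (abs_nonneg _), abs_div, abs_mul,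
      abs_of_nonneg (sq_nonneg (deriv q y)), abs_of_pos (by norm_num : (0:ℝ) < 4)]
    norm_num
  rw [this] at hx1
  linarith [hyN.1]

theorem ham_CM_asymp_pos_infinity (α κ : ℝ)
    (hα : ∀ n : ℕ, 0 < n → α + 1 / 2 ≠ (n : ℝ)) (hκ : κ ≠ 0)
    (q : ℝ → ℝ) (X : ℝ)
    (hsm : ContDiffOn ℝ (⊤ : ℕ∞) q (Ioi X))
    (hpiv : ∀ x ∈ Ioi X, PIVEq α q x)
    (hbc : CMAsymp α κ q) :
    ∃ E : ℝ → ℝ, (E =O[atTop] fun x : ℝ => x ^ (-2 : ℝ)) ∧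
      ∀ᶠ x : ℝ in atTop,
        Ham α q x =
          -(κ * (2 : ℝ) ^ (α - 1 / 2) * x ^ (2 * α - 1) * Real.exp (-x ^ 2)) * (1 + E x) := by
  obtain ⟨E, hE, hqE⟩ := hbc
  obtain ⟨K, hK0, hK⟩ := hE.exists_pos
  rw [IsBigOWith] at hK
  set A : ℝ := κ * (2 : ℝ) ^ (α - 1 / 2) with hA
  have hA0 : A ≠ 0 := mul_ne_zero hκ (by positivity)
  set p : ℝ := 2 * α - 1 with hp
  set w : ℝ → ℝ := fun x => x ^ p * Real.exp (-x ^ 2) with hw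
  have hw0 : Tendsto w atTop (nhds 0) := tendsto_rpow_mul_exp_neg_sq p
  have hwpos : ∀ x, 0 < x → 0 < w x := fun x hx => by simp only [hw]; positivity
  have hx2w : Tendsto (fun x => x ^ 2 * w x) atTop (nhds 0) := by
    refine (tendsto_rpow_mul_exp_neg_sq (p + 2)).congr' ?_
    filter_upwards [eventually_gt_atTop 0] with x hx
    rw [Real.rpow_add hx, Real.rpow_two]
    simp only [hw]; ring
  have hxw : ∀ᶠ x in atTop, |A| * (x ^ 2 * w x) < 1 := by
    have := hx2w.const_mul |A|
    rw [mul_zero] at this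
    exact this.eventually (gt_mem_nhds one_pos)
  obtain ⟨x0, hx0⟩ := (((hqE.and hK).and hxw).and
    (eventually_ge_atTop (max (X + 1) (|p| + 2 * K + 2)))).exists_forall_of_atTop
  have f1 : ∀ x, x0 ≤ x → q x = A * w x * (1 + E x) := by
    intro x hx
    rw [(hx0 x hx).1.1.1]; simp only [hw]; ring
  have f5 : ∀ x, x0 ≤ x → X < x := fun x hx => by
    have := (le_max_left _ _).trans (hx0 x hx).2; linarith
  have f6 : ∀ x, x0 ≤ x → |p| + 2 * K + 2 ≤ x := fun x hx =>
    (le_max_right _ _).trans (hx0 x hx).2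
  have f4 : ∀ x, x0 ≤ x → 1 ≤ x := fun x hx => by
    have := f6 x hx; have := abs_nonneg p; linarith
  have f2 : ∀ x, x0 ≤ x → |E x| ≤ K / x ^ 2 := by
    intro x hx
    have h := (hx0 x hx).1.1.2
    have h1 := f4 x hx
    have e : x ^ (-2 : ℝ) = (x ^ 2)⁻¹ := by
      rw [Real.rpow_neg (by linarith), Real.rpow_two]
    rw [e, Real.norm_eq_abs, Real.norm_eq_abs, abs_of_nonneg (by positivity : 0 ≤ (x ^ 2)⁻¹)] at h
    simpa [div_eq_mul_inv] using h
  have f3 : ∀ x, x0 ≤ x → |E x| ≤ 1 / 2 := by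
    intro x hx
    refine (f2 x hx).trans ?_
    have h1 := f4 x hx
    have h6 := f6 x hx
    have := abs_nonneg p
    rw [div_le_div_iff₀ (by positivity) (by norm_num)]
    nlinarith
  have f7 : ∀ x, x0 ≤ x → q x ≠ 0 := by
    intro x hx
    have h1 := f4 x hx
    rw [f1 x hx]
    have := abs_le.1 (f3 x hx)
    exact mul_ne_zero (mul_ne_zero hA0 (hwpos x (by linarith)).ne') (by linarith)
  have f8 : ∀ x, x0 ≤ x → |q x| ≤ 2 * (|A| * w x) := by
    intro x hx
    have h1 := f4 x hx
    have hwp := hwpos x (by linarith)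
    rw [f1 x hx, abs_mul, abs_mul, abs_of_pos hwp]
    have : |1 + E x| ≤ 2 := by
      have := abs_le.1 (f3 x hx)
      rw [abs_le]; constructor <;> linarith
    have h0 : 0 ≤ |A| * w x := by positivity
    nlinarith
  have d1 : ∀ x, x0 ≤ x → DifferentiableAt ℝ q x := fun x hx =>
    (hsm.differentiableOn (by simp)).differentiableAt (isOpen_Ioi.mem_nhds (f5 x hx))
  have d2 : ∀ x, x0 ≤ x → DifferentiableAt ℝ (deriv q) x := fun x hx => by
    have h := ((contDiffOn_infty_iff_deriv_of_isOpen isOpen_Ioi).1 hsm).2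
    exact (h.differentiableOn (by simp)).differentiableAt (isOpen_Ioi.mem_nhds (f5 x hx))
  -- the comparison argument
  set C : ℝ := 2 * K + |p| + 4 with hC
  have hCpos : 0 < C := by positivity
  obtain ⟨c, hc1, hc2⟩ := conv_of_dominated (fun x => Ham α q x + A * w x)
    (fun x => (q x ^ 2 + 2 * x * q x) + A * ((p / x - 2 * x) * w x))
    (fun x => C * |A| * (w x / x ^ 2))
    (fun x => C * |A| * ((((p / x - 2 * x) * w x) * x ^ 2 - w x * (2 * x)) / (x ^ 2) ^ 2)) x0
    (fun x hx => (hasDerivAt_Ham α q x (d1 x hx) (d2 x hx) (hpiv x (f5 x hx)) (f7 x hx)).add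
      ((hasDerivAt_w p x (by linarith [f4 x hx])).const_mul A))
    (fun x hx => by
      have h1 := f4 x hx
      have hh := (hasDerivAt_w p x (by linarith)).div (hasDerivAt_pow 2 x) (by positivity)
      have := hh.const_mul (C * |A|)
      simpa using this)
    (fun x hx => by
      have h1 := f4 x hx
      have hxp : 0 < x := by linarith
      have hwp := hwpos x hxp
      have hg : 0 < |A| * w x := by positivity
      have h8 := f8 x hx
      have e1 : (q x ^ 2 + 2 * x * q x) + A * ((p / x - 2 * x) * w x)
          = q x ^ 2 + (2 * x * E x + p / x) * (A * w x) := by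
        rw [show 2 * x * q x = 2 * x * (A * w x * (1 + E x)) by rw [f1 x hx]]; ring
      have e2 : -(C * |A| * ((((p / x - 2 * x) * w x) * x ^ 2 - w x * (2 * x)) / (x ^ 2) ^ 2))
          = (|A| * w x / x) * (C * (2 - (p - 2) / x ^ 2)) := by
        field_simp
        ring
      have b1 : q x ^ 2 ≤ (|A| * w x / x) * 4 := by
        have hsq : q x ^ 2 ≤ (2 * (|A| * w x)) ^ 2 := by
          rw [← sq_abs]; gcongr
        have hlt := (hx0 x hx).1.2
        have : |A| * w x ≤ 1 / x := by
          rw [le_div_iff₀ hxp]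
          nlinarith
        calc q x ^ 2 ≤ (2 * (|A| * w x)) ^ 2 := hsq
          _ = (|A| * w x) * (|A| * w x) * 4 := by ring
          _ ≤ (|A| * w x) * (1 / x) * 4 := by gcongr
          _ = _ := by ring
      have b2 : |2 * x * E x + p / x| ≤ (2 * K + |p|) / x := by
        calc |2 * x * E x + p / x| ≤ |2 * x * E x| + |p / x| := abs_add_le _ _
          _ = 2 * x * |E x| + |p| / x := by
            rw [abs_mul, abs_div, abs_of_pos hxp, abs_of_pos (by positivity : 0 < 2 * x)]
          _ ≤ 2 * x * (K / x ^ 2) + |p| / x := by gcongr; exact f2 x hx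
          _ = _ := by field_simp
      have b3 : 1 ≤ 2 - (p - 2) / x ^ 2 := by
        have : (p - 2) / x ^ 2 ≤ 1 := by
          rw [div_le_one (by positivity)]
          have := f6 x hx
          have := le_abs_self p
          nlinarith
        linarith
      rw [e1, e2]
      calc |q x ^ 2 + (2 * x * E x + p / x) * (A * w x)|
          ≤ |q x ^ 2| + |(2 * x * E x + p / x) * (A * w x)| := abs_add_le _ _
        _ = q x ^ 2 + |2 * x * E x + p / x| * (|A| * w x) := by
          rw [abs_mul, abs_mul, abs_of_pos hwp, abs_of_nonneg (sq_nonneg (q x))]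
        _ ≤ (|A| * w x / x) * 4 + (2 * K + |p|) / x * (|A| * w x) := by gcongr
        _ = (|A| * w x / x) * (C * 1) := by rw [hC]; ring
        _ ≤ _ := by gcongr)
    (by
      have h : Tendsto (fun x => w x / x ^ 2) atTop (nhds 0) := by
        refine squeeze_zero' ?_ ?_ hw0
        · filter_upwards [eventually_ge_atTop 1] with x hx
          have := hwpos x (by linarith); positivity
        · filter_upwards [eventually_ge_atTop 1] with x hx
          have := hwpos x (by linarith)
          exact div_le_self this.le (by nlinarith)
      simpa using h.const_mul (C * |A|))
  have hc0 : c = 0 := by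
    have hx2q : Tendsto (fun x => x ^ 2 * q x) atTop (nhds 0) := by
      rw [tendsto_zero_iff_abs_tendsto_zero]
      refine squeeze_zero' (g := fun x => 2 * |A| * (x ^ 2 * w x))
        (Eventually.of_forall fun x => abs_nonneg _) ?_ (by simpa using hx2w.const_mul (2 * |A|))
      filter_upwards [eventually_ge_atTop x0] with x hx
      simp only [Function.comp, abs_mul, abs_of_nonneg (sq_nonneg x)]
      have := f8 x hx
      nlinarith [sq_nonneg x]
    have hinv : Tendsto (fun x : ℝ => x⁻¹) atTop (nhds 0) := tendsto_inv_atTop_zero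
    have hq0 : Tendsto q atTop (nhds 0) := by
      have := (hinv.pow 2).mul hx2q
      simp only [mul_zero] at this
      refine this.congr' ?_
      filter_upwards [eventually_gt_atTop 0] with x hx
      field_simp
    have hxq : Tendsto (fun x => x * q x ^ 2) atTop (nhds 0) := by
      have := (hinv.mul hx2q).mul hq0
      simp only [mul_zero] at this
      refine this.congr' ?_
      filter_upwards [eventually_gt_atTop 0] with x hx
      field_simp
    have hH : Tendsto (fun x => deriv q x ^ 2 / (4 * q x)) atTop (nhds (-c)) := by
      have := ((((hq0.pow 3).div_const 4).add hxq).add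
        (hx2q.sub (hq0.const_mul (2 * α)))).sub (hc1.sub (hw0.const_mul A))
      have e : ((0:ℝ) ^ 3 / 4 + 0 + (0 - 2 * α * 0)) - (c - A * 0) = -c := by ring
      rw [e] at this
      refine this.congr fun x => ?_
      simp only [Ham]; ring
    have := limit_zero q x0 (-c) d1 f7 hq0 hH
    linarith
  subst hc0
  refine ⟨fun x => -(Ham α q x) / (A * w x) - 1, ?_, ?_⟩
  · refine IsBigO.of_bound C ?_
    filter_upwards [eventually_ge_atTop x0] with x hx
    have h1 := f4 x hx
    have hxp : 0 < x := by linarith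
    have hwp := hwpos x hxp
    have e : x ^ (-2 : ℝ) = (x ^ 2)⁻¹ := by
      rw [Real.rpow_neg (by linarith), Real.rpow_two]
    have h2 := hc2 x hx
    have hAw : A * w x ≠ 0 := mul_ne_zero hA0 hwp.ne'
    have e2 : -(Ham α q x) / (A * w x) - 1 = -((Ham α q x + A * w x - 0) / (A * w x)) := by
      field_simp
      ring
    rw [e, e2, Real.norm_eq_abs, Real.norm_eq_abs, abs_neg, abs_div, abs_mul, abs_of_pos hwp,
      abs_of_nonneg (by positivity : 0 ≤ (x ^ 2)⁻¹), div_le_iff₀ (by positivity)]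
    refine h2.trans (le_of_eq ?_)
    ring
  · filter_upwards [eventually_ge_atTop x0] with x hx
    have h1 := f4 x hx
    have hwp := hwpos x (by linarith)
    have hAw : A * w x ≠ 0 := mul_ne_zero hA0 hwp.ne'
    have e : A * x ^ p * Real.exp (-x ^ 2) = A * w x := by simp only [hw]; ring
    rw [e]
    field_simp
    ring
end
end
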